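/- arXiv:2311.03341 — 2 statements merged into one kernel-verified Lean document; each statement's English description precedes it below -/
import Mathlib

section
/- For every positive integer k, there exist ε = ε(k) > 0 and a polynomial p_k such that the following holds. Let s ≥ 2 be an integer and Δ ≥ p_k(s). If G is a graph with no K_{s,s} subgraph, with maximum degree at most Δ and average degree at least Δ^{1−ε}, then G contains an induced subgraph which is bipartite, contains no cycle of length 4 as a subgraph, and has average degree at least k. -/
open SimpleGraph

/-- `G` contains a copy of `H` as a (not necessarily induced) subgraph. -/
def HasSubgraphCopy {V W : Type} (G : SimpleGraph V) (H : SimpleGraph W) : Prop :=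
  ∃ f : H →g G, Function.Injective f

/-- `G` contains an induced copy of `H`. -/
def HasInducedCopy {V W : Type} (G : SimpleGraph V) (H : SimpleGraph W) : Prop :=
  ∃ s : Set V, Nonempty ((G.induce s) ≃g H)

/-- The graph obtained from `G` by subdividing the edge `ab` once (`none` is the new vertex). -/
def edgeSubdiv {V : Type} (G : SimpleGraph V) (a b : V) : SimpleGraph (Option V) :=
  SimpleGraph.fromRel (fun x y =>
    (∃ x' y' : V, x = some x' ∧ y = some y' ∧ G.Adj x' y' ∧
      ¬((x' = a ∧ y' = b) ∨ (x' = b ∧ y' = a))) ∨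
    (x = none ∧ (y = some a ∨ y = some b)))

/-- `IsSubdivision H S` : `S` is obtained from `H` by a finite sequence of single edge
subdivisions (edges of `H` get replaced by possibly longer paths). -/
inductive IsSubdivision : {V : Type} → SimpleGraph V → {W : Type} → SimpleGraph W → Prop
  | refl {V : Type} (G : SimpleGraph V) : IsSubdivision G G
  | step {V W : Type} (G : SimpleGraph V) (H : SimpleGraph W) (a b : W) :
      IsSubdivision G H → H.Adj a b → IsSubdivision G (edgeSubdiv H a b)

/-- `G` contains an induced subdivision of `H`, i.e. some induced subgraph of `G` is
isomorphic to a subdivision of `H`. -/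
def HasInducedSubdivision {V W : Type} (G : SimpleGraph V) (H : SimpleGraph W) : Prop :=
  ∃ (U : Type) (S : SimpleGraph U), IsSubdivision H S ∧ HasInducedCopy G S

/-- The average degree `2e(G)/|V(G)|` of a finite graph. -/
noncomputable def avgDeg {V : Type} (G : SimpleGraph V) [Fintype V] : ℝ :=
  2 * G.edgeSet.ncard / Fintype.card V

namespace IndC4

open Classical in
/-- neighbourhood as a finset -/
noncomputable def nb {V : Type} [Fintype V] (G : SimpleGraph V) (v : V) : Finset V :=
  Finset.univ.filter (fun u => G.Adj v u)

theorem mem_nb {V : Type} [Fintype V] {G : SimpleGraph V} {v u : V} :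
    u ∈ nb G v ↔ G.Adj v u := by
  simp [nb]

/-- no complete bipartite graph with sides `s`, in finset form -/
def KF {V : Type} (G : SimpleGraph V) (s : ℕ) : Prop :=
  ∀ X Y : Finset V, X.card = s → (∀ x ∈ X, ∀ y ∈ Y, G.Adj x y) → Y.card < s

theorem KF_of {V : Type} (G : SimpleGraph V) (s : ℕ)
    (h : ¬ HasSubgraphCopy G (completeBipartiteGraph (Fin s) (Fin s))) : KF G s := by
  intro X Y hX hXY
  by_contra hY
  push Not at hY
  obtain ⟨Y', hY', hc⟩ := Finset.exists_subset_card_eq hY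
  apply h
  let f : Fin s ≃ X := (Finset.equivFinOfCardEq hX).symm
  let g : Fin s ≃ Y' := (Finset.equivFinOfCardEq hc).symm
  have key : ∀ i j, G.Adj (f i : V) (g j : V) := fun i j =>
    hXY _ (f i).2 _ (hY' (g j).2)
  refine ⟨⟨Sum.elim (fun i => (f i : V)) (fun j => (g j : V)), ?_⟩, ?_⟩
  · rintro (a | a) (b | b) hab
    · simp at hab
    · exact key a b
    · exact (key b a).symm
    · simp at hab
  · rintro (a | a) (b | b) hab
    · have : (f a : V) = f b := hab
      rw [f.injective (Subtype.ext this)]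
    · have h1 : (f a : V) = g b := hab
      have := key a b
      rw [h1] at this
      exact absurd this (G.loopless.irrefl _)
    · have h1 : (g a : V) = f b := hab
      have := key b a
      rw [h1] at this
      exact absurd this (G.loopless.irrefl _)
    · have : (g a : V) = g b := hab
      rw [g.injective (Subtype.ext this)]

open Classical in
theorem bad_lt {V : Type} [Fintype V] (G : SimpleGraph V) (s : ℕ) (hs : 0 < s) (hK : KF G s) (L : ℝ)
    (hL : 4 * (s : ℝ) ≤ L) (Z : Finset V) (hZ : L ≤ Z.card) :
    (Finset.univ.filter (fun a => ((Z \ insert a (nb G a)).card : ℝ) < Z.card / L)).card < s := by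
  by_contra hcon
  push Not at hcon
  obtain ⟨X, hX, hXc⟩ := Finset.exists_subset_card_eq hcon
  have hs1 : (1 : ℝ) ≤ s := by exact_mod_cast hs
  have hL0 : 0 < L := by linarith
  set Y := Z.filter (fun y => ∀ x ∈ X, G.Adj x y) with hY
  have h1 := hK X Y hXc (fun x hx y hy => (Finset.mem_filter.1 hy).2 x hx)
  have hsub : Z ⊆ Y ∪ X.biUnion (fun x => Z \ nb G x) := by
    intro z hz
    by_cases h : ∀ x ∈ X, G.Adj x z
    · exact Finset.mem_union_left _ (Finset.mem_filter.2 ⟨hz, h⟩)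
    · push Not at h
      obtain ⟨x, hx, hxz⟩ := h
      refine Finset.mem_union_right _ (Finset.mem_biUnion.2 ⟨x, hx, ?_⟩)
      simp [hz, mem_nb, hxz]
  have h2 : (Z.card : ℝ) ≤ Y.card + ∑ x ∈ X, ((Z \ nb G x).card : ℝ) := by
    have := (Finset.card_le_card hsub).trans (Finset.card_union_le _ _)
    have h3 := this.trans (Nat.add_le_add_left Finset.card_biUnion_le _)
    exact_mod_cast h3
  have h3 : ∀ x ∈ X, ((Z \ nb G x).card : ℝ) ≤ 2 * (Z.card / L) := by
    intro x hx
    have hx' := (Finset.mem_filter.1 (hX hx)).2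
    have h4 : (Z \ nb G x).card ≤ (Z \ insert x (nb G x)).card + 1 := by
      have : Z \ nb G x ⊆ insert x (Z \ insert x (nb G x)) := by
        intro y; simp only [Finset.mem_sdiff, Finset.mem_insert]; tauto
      exact (Finset.card_le_card this).trans (Finset.card_insert_le _ _)
    have h5 : ((Z \ nb G x).card : ℝ) ≤ (Z \ insert x (nb G x)).card + 1 := by exact_mod_cast h4
    have h6 : 1 ≤ (Z.card : ℝ) / L := by rw [le_div_iff₀ hL0]; linarith
    linarith
  have h4 := Finset.sum_le_sum h3
  rw [Finset.sum_const, hXc, nsmul_eq_mul] at h4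
  have h5 : (Y.card : ℝ) < s := by exact_mod_cast h1
  have h6 : (s : ℝ) * (2 * (Z.card / L)) ≤ Z.card / 2 := by
    have : (s : ℝ) * (2 * (Z.card / L)) = (4 * s / L) * (Z.card / 2) := by field_simp; ring
    rw [this]
    have h7 : 4 * (s : ℝ) / L ≤ 1 := by rw [div_le_one hL0]; exact hL
    have : (0 : ℝ) ≤ Z.card / 2 := by positivity
    nlinarith
  linarith

open Classical in
theorem indep_count {V : Type} [Fintype V] (G : SimpleGraph V) (s : ℕ) (hs : 0 < s) (hK : KF G s)
    (L : ℝ) (hL : 4 * (s : ℝ) ≤ L) (m : ℕ) : ∀ (_ : (m : ℝ) ≤ L) (Z : Fin m → Finset V) (z : ℝ)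
    (_ : ∀ i, z ≤ (Z i).card) (_ : L ^ (m + 1) ≤ z),
    (z / L ^ m) ^ m ≤ ((Finset.univ.filter (fun y : Fin m → V => (∀ i, y i ∈ Z i) ∧
      Function.Injective y ∧ ∀ i j, ¬ G.Adj (y i) (y j))).card : ℝ) := by
  have hs1 : (1 : ℝ) ≤ s := by exact_mod_cast hs
  have hL0 : 0 < L := by linarith
  induction m with
  | zero =>
    intro _ Z z _ _
    have : (Finset.univ.filter (fun y : Fin 0 → V => (∀ i, y i ∈ Z i) ∧
      Function.Injective y ∧ ∀ i j, ¬ G.Adj (y i) (y j))) = Finset.univ := by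
      ext y
      simp [Function.injective_of_subsingleton]
    rw [this]
    simp
  | succ m ih =>
    intro hm Z z hz hzL
    push_cast at hm
    have hzL2 : L ^ 2 ≤ z := by
      refine le_trans ?_ hzL
      exact pow_le_pow_right₀ (by linarith) (by omega)
    have hzL1 : L ≤ z := by nlinarith
    set bad : Fin m → Finset V := fun j => Finset.univ.filter (fun a =>
      ((Z j.succ \ insert a (nb G a)).card : ℝ) < (Z j.succ).card / L) with hbad
    have hb : ∀ j, (bad j).card ≤ s := fun j =>
      (bad_lt G s hs hK L hL (Z j.succ) (hzL1.trans (hz _))).le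
    set good := Z 0 \ Finset.univ.biUnion bad with hgood
    have hg : z / L ≤ good.card := by
      have h1 : (Finset.univ.biUnion bad).card ≤ m * s := by
        refine Finset.card_biUnion_le.trans ?_
        refine (Finset.sum_le_sum (fun j _ => hb j)).trans ?_
        simp
      have h2 := Finset.le_card_sdiff (Finset.univ.biUnion bad) (Z 0)
      rw [← hgood] at h2
      have h3 : (Z 0).card ≤ good.card + m * s := by omega
      have h4 : ((Z 0).card : ℝ) ≤ good.card + m * s := by exact_mod_cast h3
      have h5 := hz 0
      have h6 : (m : ℝ) * s ≤ L ^ 2 / 4 := by nlinarith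
      have h7 : z / L ≤ z / 4 := by
        apply div_le_div_of_nonneg_left <;> linarith
      nlinarith
    set Z' : V → Fin m → Finset V := fun a j => Z j.succ \ insert a (nb G a) with hZ'
    set F : V → Finset (Fin m → V) := fun a => Finset.univ.filter (fun y : Fin m → V =>
      (∀ i, y i ∈ Z' a i) ∧ Function.Injective y ∧ ∀ i j, ¬ G.Adj (y i) (y j)) with hF
    have hrec : ∀ a ∈ good, (z / L / L ^ m) ^ m ≤ (F a).card := by
      intro a ha
      apply ih (by linarith) (Z' a) (z / L)
      · intro i
        have h1 : a ∉ bad i := by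
          intro h
          exact (Finset.mem_sdiff.1 ha).2 (Finset.mem_biUnion.2 ⟨i, Finset.mem_univ _, h⟩)
        simp only [hbad, Finset.mem_filter, Finset.mem_univ, true_and, not_lt] at h1
        refine le_trans ?_ h1
        exact div_le_div_of_nonneg_right (hz _) hL0.le
      · rw [le_div_iff₀ hL0]
        rw [← pow_succ]; exact hzL
    have hcard : (good.sigma F).card ≤ (Finset.univ.filter (fun y : Fin (m+1) → V =>
      (∀ i, y i ∈ Z i) ∧ Function.Injective y ∧ ∀ i j, ¬ G.Adj (y i) (y j))).card := by
      apply Finset.card_le_card_of_injOn (fun p => (Fin.cons p.1 p.2 : Fin (m+1) → V))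
      · rintro ⟨a, y⟩ h
        simp only [Finset.coe_sigma, Set.mem_sigma_iff, Finset.mem_coe, hF, Finset.mem_filter,
          Finset.mem_univ, true_and, hZ', Finset.mem_sdiff, Finset.mem_insert, not_or, mem_nb] at h
        obtain ⟨ha, h1, h2, h3⟩ := h
        simp only [Finset.coe_filter, Finset.mem_univ, true_and, Set.mem_ofPred_eq]
        refine ⟨?_, ?_, ?_⟩
        · intro i
          refine Fin.cases ?_ (fun j => ?_) i
          · simpa using (Finset.mem_sdiff.1 ha).1
          · simpa using (h1 j).1
        · rw [Fin.cons_injective_iff]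
          refine ⟨?_, h2⟩
          rintro ⟨j, hj⟩
          exact (h1 j).2.1 hj
        · intro i j
          refine Fin.cases ?_ (fun i => ?_) i <;> refine Fin.cases ?_ (fun j => ?_) j
          · simp
          · simpa using (h1 j).2.2
          · simpa [G.adj_comm] using (h1 i).2.2
          · simpa using h3 i j
      · rintro ⟨a, y⟩ _ ⟨b, y'⟩ _ h
        have h := Fin.cons_injective2 h
        obtain ⟨h1, h2⟩ := h
        subst h1; subst h2; rfl
    rw [Finset.card_sigma] at hcard
    have h1 : (good.card : ℝ) * (z / L / L ^ m) ^ m ≤ ∑ a ∈ good, ((F a).card : ℝ) := by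
      have := Finset.sum_le_sum hrec
      rwa [Finset.sum_const, nsmul_eq_mul] at this
    have h2 : ∑ a ∈ good, ((F a).card : ℝ) ≤ ((Finset.univ.filter (fun y : Fin (m+1) → V =>
      (∀ i, y i ∈ Z i) ∧ Function.Injective y ∧ ∀ i j, ¬ G.Adj (y i) (y j))).card : ℝ) := by
      exact_mod_cast hcard
    refine le_trans ?_ (h1.trans h2)
    have hz0 : 0 < z := by linarith
    have e1 : z / L / L ^ m = z / L ^ (m+1) := by rw [div_div, pow_succ']
    rw [e1, pow_succ, mul_comm]
    apply mul_le_mul_of_nonneg_right _ (by positivity)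
    refine le_trans ?_ hg
    apply div_le_div_of_nonneg_left hz0.le hL0
    have : L ^ 1 ≤ L ^ (m+1) := pow_le_pow_right₀ (by linarith) (by omega)
    simpa using this

end IndC4

namespace IndC4

open Classical in
theorem drc {V : Type} [Fintype V] (G : SimpleGraph V) (A B : Finset V) (L : ℝ) (hL : 1 ≤ L)
    (M e W h : ℕ) (hA : (A.card : ℝ) ≤ L ^ M) (hB : L ^ M ≤ L ^ e * B.card)
    (hd : ∀ b ∈ B, L ^ M ≤ L ^ e * (A.filter (fun a => G.Adj b a)).card)
    (hM : (e + W) * (h + 1) ≤ M) :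
    ∃ A' ⊆ A, L ^ M ≤ L ^ (e * (h + 1)) * (A'.card + 1) ∧
      (((Fintype.piFinset (fun _ : Fin h => A')).filter (fun x =>
        ((B.filter (fun b => ∀ j, G.Adj b (x j))).card : ℝ) < L ^ W)).card : ℝ) ≤ A'.card := by
  have hL0 : 0 < L := by linarith
  have hBpos : (0 : ℝ) < B.card := by
    by_contra hcon
    have h1 : (B.card : ℝ) = 0 := le_antisymm (not_lt.1 hcon) (Nat.cast_nonneg _)
    rw [h1, mul_zero] at hB
    have : 0 < L ^ M := by positivity
    linarith
  have hBne : B.Nonempty := by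
    rw [← Finset.card_pos]; exact_mod_cast hBpos
  have hApos : (0 : ℝ) < A.card := by
    obtain ⟨b, hb⟩ := hBne
    have h1 := hd b hb
    by_contra hcon
    have h2 : A = ∅ := by
      rw [← Finset.card_eq_zero]
      by_contra h3
      exact hcon (by exact_mod_cast Nat.pos_of_ne_zero h3)
    rw [h2] at h1
    simp at h1
    have : 0 < L ^ M := by positivity
    linarith
  set TT := Fintype.piFinset (fun _ : Fin (h+1) => B) with hTT
  have hTcard : (TT.card : ℝ) = (B.card : ℝ) ^ (h+1) := by
    rw [hTT, Fintype.card_piFinset_const]; push_cast; rfl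
  set A' : (Fin (h+1) → V) → Finset V := fun T => A.filter (fun a => ∀ i, G.Adj (T i) a) with hA'
  set bad : (Fin (h+1) → V) → Finset (Fin h → V) := fun T =>
    (Fintype.piFinset (fun _ : Fin h => A' T)).filter (fun x =>
        ((B.filter (fun b => ∀ j, G.Adj b (x j))).card : ℝ) < L ^ W) with hbad
  -- first moment
  have s1 : ∑ T ∈ TT, ((A' T).card : ℝ) =
      ∑ a ∈ A, ((B.filter (fun b => G.Adj b a)).card : ℝ) ^ (h+1) := by
    have := Finset.sum_card_bipartiteAbove_eq_sum_card_bipartiteBelow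
      (fun (T : Fin (h+1) → V) (a : V) => ∀ i, G.Adj (T i) a) (s := TT) (t := A)
    have h2 : ∀ a ∈ A, (Finset.bipartiteBelow
      (fun (T : Fin (h+1) → V) (a : V) => ∀ i, G.Adj (T i) a) TT a).card
        = (B.filter (fun b => G.Adj b a)).card ^ (h+1) := by
      intro a _
      rw [← Fintype.card_piFinset_const]
      congr 1
      ext T
      simp only [Finset.bipartiteBelow, hTT, Finset.mem_filter, Fintype.mem_piFinset]
      exact forall_and.symm
    rw [Finset.sum_congr rfl h2] at this
    have h3 : ∑ T ∈ TT, (A' T).card = ∑ a ∈ A, (B.filter (fun b => G.Adj b a)).card ^ (h+1) := by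
      rw [← this]; rfl
    exact_mod_cast h3
  have s2 : (∑ a ∈ A, ((B.filter (fun b => G.Adj b a)).card : ℝ)) =
      ∑ b ∈ B, ((A.filter (fun a => G.Adj b a)).card : ℝ) := by
    have := Finset.sum_card_bipartiteAbove_eq_sum_card_bipartiteBelow
      (fun (b : V) (a : V) => G.Adj b a) (s := B) (t := A)
    have h3 : (∑ a ∈ A, ((B.filter (fun b => G.Adj b a)).card)) =
      ∑ b ∈ B, ((A.filter (fun a => G.Adj b a)).card) := this.symm
    exact_mod_cast h3
  have s3 : (B.card : ℝ) * (L ^ M / L ^ e) ≤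
      ∑ a ∈ A, ((B.filter (fun b => G.Adj b a)).card : ℝ) := by
    rw [s2, ← nsmul_eq_mul, ← Finset.sum_const]
    apply Finset.sum_le_sum
    intro b hb
    rw [div_le_iff₀ (by positivity), mul_comm]
    exact hd b hb
  have s4 : (B.card : ℝ) ^ (h+1) * (L ^ M / L ^ (e * (h+1))) ≤ ∑ T ∈ TT, ((A' T).card : ℝ) := by
    rw [s1]
    refine le_trans ?_ (pow_sum_div_card_le_sum_pow (s := A)
      (f := fun a => ((B.filter (fun b => G.Adj b a)).card : ℝ)) (fun i _ => by positivity) h)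
    rw [le_div_iff₀ (by positivity)]
    have h1 := pow_le_pow_left₀ (by positivity) s3 (h+1)
    refine le_trans ?_ h1
    have h2 : (A.card : ℝ) ^ h ≤ (L ^ M) ^ h := pow_le_pow_left₀ (by positivity) hA h
    calc (B.card : ℝ) ^ (h+1) * (L ^ M / L ^ (e * (h+1))) * (A.card : ℝ) ^ h
        ≤ (B.card : ℝ) ^ (h+1) * (L ^ M / L ^ (e * (h+1))) * (L ^ M) ^ h := by gcongr
      _ = ((B.card : ℝ) * (L ^ M / L ^ e)) ^ (h+1) := by
        rw [mul_pow, div_pow, pow_mul, pow_succ (L ^ M) h]; ring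
  -- bad tuples
  have s5 : ∑ T ∈ TT, ((bad T).card : ℝ) ≤ (B.card : ℝ) ^ (h+1) := by
    set X := (Fintype.piFinset (fun _ : Fin h => A)).filter (fun x =>
        ((B.filter (fun b => ∀ j, G.Adj b (x j))).card : ℝ) < L ^ W) with hX
    have h1 := Finset.sum_card_bipartiteAbove_eq_sum_card_bipartiteBelow
      (fun (T : Fin (h+1) → V) (x : Fin h → V) => ∀ i j, G.Adj (T i) (x j)) (s := TT) (t := X)
    have h2 : ∀ x ∈ X, (Finset.bipartiteBelow
      (fun (T : Fin (h+1) → V) (x : Fin h → V) => ∀ i j, G.Adj (T i) (x j)) TT x).card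
        = (B.filter (fun b => ∀ j, G.Adj b (x j))).card ^ (h+1) := by
      intro x _
      rw [← Fintype.card_piFinset_const]
      congr 1
      ext T
      simp only [Finset.bipartiteBelow, hTT, Finset.mem_filter, Fintype.mem_piFinset]
      exact forall_and.symm
    rw [Finset.sum_congr rfl h2] at h1
    have h3 : ∀ T ∈ TT, (bad T).card ≤ (Finset.bipartiteAbove
      (fun (T : Fin (h+1) → V) (x : Fin h → V) => ∀ i j, G.Adj (T i) (x j)) X T).card := by
      intro T _
      apply Finset.card_le_card
      intro x hx
      simp only [hbad, hA', Finset.mem_filter, Fintype.mem_piFinset] at hx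
      simp only [Finset.bipartiteAbove, hX, Finset.mem_filter, Fintype.mem_piFinset]
      exact ⟨⟨fun a => (hx.1 a).1, hx.2⟩, fun i j => (hx.1 j).2 i⟩
    have h4 := Finset.sum_le_sum h3
    rw [h1] at h4
    have h5 : ∑ T ∈ TT, ((bad T).card : ℝ) ≤
        ∑ x ∈ X, ((B.filter (fun b => ∀ j, G.Adj b (x j))).card : ℝ) ^ (h+1) := by
      exact_mod_cast h4
    refine h5.trans ?_
    have h6 : ∀ x ∈ X, ((B.filter (fun b => ∀ j, G.Adj b (x j))).card : ℝ) ^ (h+1) ≤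
        (L ^ W) ^ (h+1) := by
      intro x hx
      exact pow_le_pow_left₀ (by positivity) (Finset.mem_filter.1 hx).2.le _
    refine (Finset.sum_le_sum h6).trans ?_
    rw [Finset.sum_const, nsmul_eq_mul]
    have h7 : (X.card : ℝ) ≤ (L ^ M) ^ h := by
      have : X.card ≤ A.card ^ h := by
        refine (Finset.card_le_card (Finset.filter_subset _ _)).trans ?_
        rw [Fintype.card_piFinset_const]
      have h8 : (X.card : ℝ) ≤ (A.card : ℝ) ^ h := by exact_mod_cast this
      exact h8.trans (pow_le_pow_left₀ (by positivity) hA h)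
    have h8 : (L ^ M) ^ (h+1) ≤ (L ^ e * B.card) ^ (h+1) := pow_le_pow_left₀ (by positivity) hB _
    have h9 : L ^ ((e + W) * (h+1)) ≤ L ^ M := pow_le_pow_right₀ hL hM
    have h10 : (0 : ℝ) < (L ^ e) ^ (h+1) := by positivity
    rw [← mul_le_mul_iff_right₀ h10, ← mul_pow]
    refine le_trans ?_ h8
    calc (L ^ e) ^ (h+1) * ((X.card : ℝ) * (L ^ W) ^ (h+1))
        ≤ (L ^ e) ^ (h+1) * ((L ^ M) ^ h * (L ^ W) ^ (h+1)) := by gcongr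
      _ = (L ^ M) ^ h * L ^ ((e + W) * (h+1)) := by rw [pow_mul, pow_add L e W, mul_pow (L ^ e)]; ring
      _ ≤ (L ^ M) ^ h * L ^ M := by gcongr
      _ = (L ^ M) ^ (h+1) := by rw [pow_succ]
  have hTne : TT.Nonempty := by
    rw [hTT, Fintype.piFinset_nonempty]; exact fun _ => hBne
  have s6 : ∑ T ∈ TT, (L ^ M / L ^ (e * (h+1)) - 1) ≤
      ∑ T ∈ TT, (((A' T).card : ℝ) - (bad T).card) := by
    rw [Finset.sum_const, Finset.sum_sub_distrib, nsmul_eq_mul, hTcard]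
    linarith
  obtain ⟨T, _, hT⟩ := Finset.exists_le_of_sum_le hTne s6
  have hge : 1 ≤ L ^ M / L ^ (e * (h+1)) := by
    rw [le_div_iff₀ (by positivity), one_mul]
    apply pow_le_pow_right₀ hL
    refine le_trans ?_ hM
    exact Nat.mul_le_mul_right _ (Nat.le_add_right _ _)
  refine ⟨A' T, Finset.filter_subset _ _, ?_, ?_⟩
  · have : L ^ M / L ^ (e * (h+1)) ≤ (A' T).card + 1 := by
      have : (0 : ℝ) ≤ (bad T).card := by positivity
      linarith
    rwa [div_le_iff₀ (by positivity), mul_comm] at this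
  · have : ((bad T).card : ℝ) ≤ (A' T).card := by linarith
    exact this

open Classical in
theorem coord_count {V : Type} [Fintype V] (h : ℕ) (A : Finset V) (s : ℕ) (i : Fin h)
    (P : (Fin h → V) → Prop)
    (hP : ∀ x, (A.filter (fun a => P (Function.update x i a))).card ≤ s) :
    ((Fintype.piFinset (fun _ : Fin h => A)).filter P).card ≤ s * A.card ^ (h - 1) := by
  have h1 := Finset.card_le_mul_card_image_of_maps_to
    (f := fun (x : Fin h → V) (j : {j : Fin h // j ≠ i}) => x j)
    (s := (Fintype.piFinset (fun _ : Fin h => A)).filter P)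
    (t := Fintype.piFinset (fun _ : {j : Fin h // j ≠ i} => A)) ?_ s ?_
  · refine h1.trans (le_of_eq ?_)
    congr 1
    simp
  · intro x hx
    simp only [Finset.mem_filter, Fintype.mem_piFinset] at hx ⊢
    exact fun j => hx.1 j
  · intro b _
    rcases Finset.eq_empty_or_nonempty (((Fintype.piFinset (fun _ : Fin h => A)).filter P).filter
      (fun x => (fun (j : {j : Fin h // j ≠ i}) => x j) = b)) with h0 | ⟨x0, hx0⟩
    · rw [h0]; simp
    · have key : ∀ x ∈ (((Fintype.piFinset (fun _ : Fin h => A)).filter P).filter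
          (fun x => (fun (j : {j : Fin h // j ≠ i}) => x j) = b)),
          x = Function.update x0 i (x i) := by
        intro x hx
        have e1 := (Finset.mem_filter.1 hx).2
        have e2 := (Finset.mem_filter.1 hx0).2
        funext j
        by_cases hj : j = i
        · subst hj; simp
        · rw [Function.update_of_ne hj]
          have := congrFun (e1.trans e2.symm) ⟨j, hj⟩
          exact this
      refine le_trans ?_ (hP x0)
      apply Finset.card_le_card_of_injOn (fun x => x i)
      · intro x hx
        have hx' := hx
        simp only [Finset.coe_filter, Finset.mem_filter, Fintype.mem_piFinset,
          Set.mem_ofPred_eq] at hx'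
        simp only [Finset.coe_filter, Set.mem_ofPred_eq]
        refine ⟨hx'.1.1 i, ?_⟩
        rw [← key x hx]; exact hx'.1.2
      · intro x hx y hy hxy
        rw [key x hx, key y hy]
        exact congrArg _ hxy

end IndC4

namespace IndC4

open Classical in
/-- candidates for the vertex `q` of the right side after `n` steps -/
noncomputable def cand {V : Type} [Fintype V] (G : SimpleGraph V) (B : Finset V) {h h' : ℕ}
    (H : Fin h → Fin h' → Prop) (q : Fin h') (n : ℕ) (x : Fin h → V) : Finset V :=
  B.filter (fun b => (∀ p, H p q → G.Adj b (x p)) ∧ ∀ p : Fin h, p.val < n → ¬ H p q → ¬ G.Adj b (x p))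

open Classical in
theorem dense {V : Type} [Fintype V] (G : SimpleGraph V) (s : ℕ) (hs : 0 < s) (hK : KF G s)
    (L : ℝ) (hL : 4 * (s : ℝ) ≤ L) (h h' : ℕ) (hh : 2 ≤ h) (H : Fin h → Fin h' → Prop)
    (hLh : (h : ℝ) * h' + h + h' + 1 ≤ L)
    (A B : Finset V) (M e : ℕ)
    (hA : (A.card : ℝ) ≤ L ^ M) (hB : L ^ M ≤ L ^ e * B.card)
    (hd : ∀ b ∈ B, L ^ M ≤ L ^ e * (A.filter (fun a => G.Adj b a)).card)
    (hM : (e + (h + h' + 1)) * (h + 1) + h * h + 4 ≤ M) :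
    ∃ (x : Fin h → V) (y : Fin h' → V), (∀ i j, G.Adj (x i) (y j) ↔ H i j) ∧
      Function.Injective x ∧ Function.Injective y ∧
      (∀ i j, ¬ G.Adj (x i) (x j)) ∧ (∀ i j, ¬ G.Adj (y i) (y j)) := by
  have hs1 : (1 : ℝ) ≤ s := by exact_mod_cast hs
  have hL0 : 0 < L := by linarith
  have hL1 : 1 ≤ L := by linarith
  set W := h + h' + 1 with hW
  obtain ⟨A', hA'A, hA'1, hA'2⟩ := drc G A B L hL1 M e W h hA hB hd (by omega)
  set z : ℝ := (A'.card : ℝ) with hz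
  have hzbig : L ^ (h * h + 3) ≤ z := by
    have h1 : L ^ (e * (h+1)) * L ^ (h * h + 4) ≤ L ^ (e * (h+1)) * (z + 1) := by
      refine le_trans ?_ hA'1
      rw [← pow_add]
      apply pow_le_pow_right₀ hL1
      have : e * (h + 1) ≤ (e + W) * (h+1) := Nat.mul_le_mul_right _ (Nat.le_add_right _ _)
      omega
    have h2 := le_of_mul_le_mul_left h1 (by positivity)
    have h3 : 1 ≤ L ^ (h * h + 3) := one_le_pow₀ hL1
    have h4 : L ^ (h * h + 4) = L ^ (h * h + 3) * L := pow_succ _ _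
    nlinarith
  have hz0 : 0 < z := lt_of_lt_of_le (by positivity) hzbig
  have hhL : (h : ℝ) ≤ L := by
    have : (0 : ℝ) ≤ (h : ℝ) * h' := by positivity
    have : (0 : ℝ) ≤ (h' : ℝ) := by positivity
    linarith
  have hhL' : (h' : ℝ) ≤ L := by
    have : (0 : ℝ) ≤ (h : ℝ) * h' := by positivity
    have : (0 : ℝ) ≤ (h : ℝ) := by positivity
    linarith
  have hz1 : 1 ≤ z := le_trans (one_le_pow₀ hL1) hzbig
  have hind := indep_count G s hs hK L hL h hhL (fun _ => A') z (fun _ => le_rfl) (by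
    refine le_trans (pow_le_pow_right₀ hL1 ?_) hzbig
    nlinarith)
  set I := (Finset.univ.filter (fun y : Fin h → V => (∀ i, y i ∈ A') ∧
      Function.Injective y ∧ ∀ i j, ¬ G.Adj (y i) (y j))) with hI
  set bad2 := ((Fintype.piFinset (fun _ : Fin h => A')).filter (fun x =>
        ((B.filter (fun b => ∀ j, G.Adj b (x j))).card : ℝ) < L ^ W)) with hbad2
  set P : Fin h' → Fin h → (Fin h → V) → Prop := fun q i x => ¬ H i q ∧
    L ≤ (cand G B H q i.val x).card ∧
    ((cand G B H q i.val x \ insert (x i) (nb G (x i))).card : ℝ) <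
      (cand G B H q i.val x).card / L with hP
  set bad3 : Fin h' × Fin h → Finset (Fin h → V) := fun t =>
    (Fintype.piFinset (fun _ : Fin h => A')).filter (P t.1 t.2) with hbad3
  have hb3 : ∀ t, (bad3 t).card ≤ s * A'.card ^ (h - 1) := by
    rintro ⟨q, i⟩
    suffices hsuf : ∀ x : Fin h → V,
        (A'.filter (fun a => P q i (Function.update x i a))).card ≤ s by
      have hcc := coord_count h A' s i (P q i) (by
        intro x
        convert hsuf x)
      convert hcc
    intro x
    by_cases hH : H i q
    · have : A'.filter (fun a => P q i (Function.update x i a)) = ∅ := by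
        apply Finset.filter_false_of_mem
        intro a _ hPa
        exact hPa.1 hH
      rw [this]; simp
    · have hc : ∀ a, cand G B H q i.val (Function.update x i a) = cand G B H q i.val x := by
        intro a
        unfold cand
        apply Finset.filter_congr
        intro b _
        apply and_congr
        · apply forall_congr'
          intro p
          by_cases hpi : p = i
          · subst hpi; simp [hH]
          · rw [Function.update_of_ne hpi]
        · apply forall_congr'
          intro p
          by_cases hpi : p = i
          · subst hpi; simp
          · rw [Function.update_of_ne hpi]
      by_cases hbig : L ≤ (cand G B H q i.val x).card
      · refine le_trans (Finset.card_le_card ?_)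
          (bad_lt G s hs hK L hL (cand G B H q i.val x) hbig).le
        intro a ha
        have h1 := (Finset.mem_filter.1 ha).2
        simp only [hP] at h1
        rw [hc, Function.update_self] at h1
        simp only [Finset.mem_filter, Finset.mem_univ, true_and]
        exact h1.2.2
      · have : A'.filter (fun a => P q i (Function.update x i a)) = ∅ := by
          apply Finset.filter_false_of_mem
          intro a _ hPa
          have := hPa.2.1
          rw [hc] at this
          exact hbig this
        rw [this]; simp
  have hex : ∃ x ∈ I, x ∉ bad2 ∧ ∀ t, x ∉ bad3 t := by
    by_contra hcon
    push Not at hcon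
    have hsub : I ⊆ bad2 ∪ Finset.univ.biUnion bad3 := by
      intro x hx
      by_cases hx2 : x ∈ bad2
      · exact Finset.mem_union_left _ hx2
      · obtain ⟨t, ht⟩ := hcon x hx hx2
        exact Finset.mem_union_right _ (Finset.mem_biUnion.2 ⟨t, Finset.mem_univ _, ht⟩)
    have h1 : I.card ≤ bad2.card + h' * h * (s * A'.card ^ (h - 1)) := by
      refine (Finset.card_le_card hsub).trans ((Finset.card_union_le _ _).trans ?_)
      apply Nat.add_le_add_left
      refine Finset.card_biUnion_le.trans ((Finset.sum_le_sum (fun t _ => hb3 t)).trans ?_)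
      simp
    have h2 : (I.card : ℝ) ≤ bad2.card + h' * h * (s * z ^ (h - 1)) := by
      rw [hz]; exact_mod_cast h1
    have h3 : (z / L ^ h) ^ h ≤ z + h' * h * (s * z ^ (h - 1)) := by linarith
    have h4 : z ≤ z ^ (h - 1) := by
      have : z ^ 1 ≤ z ^ (h-1) := pow_le_pow_right₀ hz1 (by omega)
      simpa using this
    have h5 : (z / L ^ h) ^ h ≤ (1 + h' * h * s) * z ^ (h - 1) := by nlinarith
    have h6 : (z / L ^ h) ^ h = z * z ^ (h-1) / L ^ (h * h) := by
      rw [div_pow, ← pow_mul]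
      congr 1
      rw [← pow_succ']
      congr 1; omega
    rw [h6, div_le_iff₀ (by positivity)] at h5
    have h7 : (0 : ℝ) < z ^ (h-1) := by positivity
    have h8 : z ≤ (1 + h' * h * s) * L ^ (h * h) := by
      by_contra hc
      push Not at hc
      nlinarith
    have h9 : (1 : ℝ) + h' * h * s ≤ L * L := by
      have : (0 : ℝ) ≤ (h : ℝ) * h' := by positivity
      have : (0 : ℝ) ≤ (h : ℝ) := by positivity
      have : (0 : ℝ) ≤ (h' : ℝ) := by positivity
      nlinarith
    have h10 : L ^ (h * h + 3) = L ^ (h * h) * L * L * L := by ring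
    have h11 : (0 : ℝ) < L ^ (h * h) := by positivity
    have h12 : z ≤ L * L * L ^ (h * h) := h8.trans (mul_le_mul_of_nonneg_right h9 h11.le)
    have h13 : (0 : ℝ) < L * L * L ^ (h * h) := by positivity
    nlinarith
  obtain ⟨x, hxI, hx2, hx3⟩ := hex
  simp only [hI, Finset.mem_filter, Finset.mem_univ, true_and] at hxI
  obtain ⟨hxA, hxinj, hxadj⟩ := hxI
  have hxpi : x ∈ Fintype.piFinset (fun _ : Fin h => A') := by
    rw [Fintype.mem_piFinset]; exact hxA
  have hx2' : L ^ W ≤ ((B.filter (fun b => ∀ j, G.Adj b (x j))).card : ℝ) := by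
    by_contra hc
    exact hx2 (Finset.mem_filter.2 ⟨hxpi, not_le.1 hc⟩)
  have hx3' : ∀ q i, ¬ P q i x := fun q i hc => hx3 (q, i) (Finset.mem_filter.2 ⟨hxpi, hc⟩)
  have hcand : ∀ q, ∀ n ≤ h, L ^ W ≤ L ^ n * (cand G B H q n x).card := by
    intro q n
    induction n with
    | zero =>
      intro _
      rw [pow_zero, one_mul]
      refine hx2'.trans ?_
      have : (B.filter (fun b => ∀ j, G.Adj b (x j))) ⊆ cand G B H q 0 x := by
        intro b hb
        simp only [cand, Finset.mem_filter] at hb ⊢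
        exact ⟨hb.1, fun p _ => hb.2 p, fun p hp => absurd hp (Nat.not_lt_zero _)⟩
      exact_mod_cast Finset.card_le_card this
    | succ n ih =>
      intro hn
      have ih := ih (by omega)
      set i : Fin h := ⟨n, by omega⟩ with hi
      have hLn : (0 : ℝ) < L ^ n := by positivity
      have hbig : L ≤ (cand G B H q n x).card := by
        have h1 : L ^ n * L ≤ L ^ n * (cand G B H q n x).card := by
          refine le_trans ?_ ih
          rw [← pow_succ]
          exact pow_le_pow_right₀ hL1 (by omega)
        exact le_of_mul_le_mul_left h1 hLn
      by_cases hH : H i q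
      · have : cand G B H q n x ⊆ cand G B H q (n+1) x := by
          intro b hb
          simp only [cand, Finset.mem_filter] at hb ⊢
          refine ⟨hb.1, hb.2.1, fun p hp hHp => ?_⟩
          by_cases hpn : p.val < n
          · exact hb.2.2 p hpn hHp
          · have : p = i := Fin.ext (by simp [hi]; omega)
            exact absurd (this ▸ hH) hHp
        have h1 : ((cand G B H q n x).card : ℝ) ≤ (cand G B H q (n+1) x).card := by
          exact_mod_cast Finset.card_le_card this
        have h2 : L ^ n ≤ L ^ (n+1) := pow_le_pow_right₀ hL1 (by omega)
        exact ih.trans (mul_le_mul h2 h1 (by positivity) (by positivity))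
      · have h0 := hx3' q i
        simp only [hP, not_and, not_lt] at h0
        have h1 := h0 hH hbig
        have : cand G B H q n x \ insert (x i) (nb G (x i)) ⊆ cand G B H q (n+1) x := by
          intro b hb
          simp only [cand, Finset.mem_filter, Finset.mem_sdiff, Finset.mem_insert, mem_nb,
            not_or] at hb ⊢
          refine ⟨hb.1.1, hb.1.2.1, fun p hp hHp => ?_⟩
          by_cases hpn : p.val < n
          · exact hb.1.2.2 p hpn hHp
          · have : p = i := Fin.ext (by simp [hi]; omega)
            rw [this, G.adj_comm]
            exact hb.2.2
        have h2 : ((cand G B H q n x \ insert (x i) (nb G (x i))).card : ℝ) ≤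
            (cand G B H q (n+1) x).card := by
          exact_mod_cast Finset.card_le_card this
        have h3 := h1.trans h2
        rw [div_le_iff₀ hL0] at h3
        calc L ^ W ≤ L ^ n * (cand G B H q n x).card := ih
          _ ≤ L ^ n * ((cand G B H q (n+1) x).card * L) := by gcongr
          _ = L ^ (n+1) * (cand G B H q (n+1) x).card := by ring
  have hcand' : ∀ q, L ^ (h' + 1) ≤ ((cand G B H q h x).card : ℝ) := by
    intro q
    have h1 := hcand q h le_rfl
    have h2 : L ^ W = L ^ h * L ^ (h' + 1) := by rw [← pow_add, hW, add_assoc]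
    rw [h2] at h1
    exact le_of_mul_le_mul_left h1 (by positivity)
  have hy := indep_count G s hs hK L hL h' hhL' (fun q => cand G B H q h x) (L ^ (h'+1)) hcand' le_rfl
  have hpos : (0 : ℝ) < (L ^ (h'+1) / L ^ h') ^ h' := by positivity
  have hpos' := lt_of_lt_of_le hpos hy
  have hpos'' : 0 < (Finset.univ.filter (fun y : Fin h' → V => (∀ i, y i ∈ cand G B H i h x) ∧
      Function.Injective y ∧ ∀ i j, ¬ G.Adj (y i) (y j))).card := by exact_mod_cast hpos'
  obtain ⟨y, hy⟩ := Finset.card_pos.1 hpos''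
  simp only [Finset.mem_filter, Finset.mem_univ, true_and] at hy
  refine ⟨x, y, ?_, hxinj, hy.2.1, hxadj, hy.2.2⟩
  intro i j
  have h1 := hy.1 j
  simp only [cand, Finset.mem_filter] at h1
  rw [G.adj_comm]
  by_cases hH : H i j
  · simp [hH, h1.2.1 i hH]
  · simp [hH, h1.2.2 i i.isLt hH]

end IndC4

namespace IndC4

/-- expectation over a `p`-random subset of `U` -/
noncomputable def Ex {V : Type} (U : Finset V) (p : ℝ) (F : Finset V → ℝ) : ℝ :=
  ∑ A ∈ U.powerset, p ^ A.card * (1 - p) ^ (U.card - A.card) * F A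

theorem Ex_sum {V ι : Type} (U : Finset V) (p : ℝ) (I : Finset ι) (F : ι → Finset V → ℝ) :
    Ex U p (fun A => ∑ i ∈ I, F i A) = ∑ i ∈ I, Ex U p (F i) := by
  unfold Ex
  rw [Finset.sum_comm]
  simp_rw [Finset.mul_sum]

theorem Ex_sub {V : Type} (U : Finset V) (p : ℝ) (F F' : Finset V → ℝ) :
    Ex U p (fun A => F A - F' A) = Ex U p F - Ex U p F' := by
  unfold Ex
  rw [← Finset.sum_sub_distrib]
  simp_rw [mul_sub]

theorem Ex_add {V : Type} (U : Finset V) (p : ℝ) (F F' : Finset V → ℝ) :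
    Ex U p (fun A => F A + F' A) = Ex U p F + Ex U p F' := by
  unfold Ex
  rw [← Finset.sum_add_distrib]
  simp_rw [mul_add]

theorem Ex_mul {V : Type} (U : Finset V) (p c : ℝ) (F : Finset V → ℝ) :
    Ex U p (fun A => c * F A) = c * Ex U p F := by
  unfold Ex
  rw [Finset.mul_sum]
  apply Finset.sum_congr rfl
  intro A _
  ring

theorem Ex_mono {V : Type} (U : Finset V) (p : ℝ) (hp0 : 0 ≤ p) (hp1 : p ≤ 1)
    (F F' : Finset V → ℝ) (h : ∀ A, A ⊆ U → F A ≤ F' A) : Ex U p F ≤ Ex U p F' := by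
  unfold Ex
  apply Finset.sum_le_sum
  intro A hA
  apply mul_le_mul_of_nonneg_left (h A (Finset.mem_powerset.1 hA))
  have : 0 ≤ 1 - p := by linarith
  positivity

theorem Ex_const {V : Type} (U : Finset V) (p c : ℝ) : Ex U p (fun _ => c) = c := by
  unfold Ex
  rw [← Finset.sum_mul, Finset.sum_pow_mul_eq_add_pow]
  simp

theorem Ex_exists {V : Type} (U : Finset V) (p : ℝ) (hp0 : 0 < p) (hp1 : p < 1)
    (F : Finset V → ℝ) (c : ℝ) (h : c ≤ Ex U p F) : ∃ A, A ⊆ U ∧ c ≤ F A := by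
  rw [← Ex_const U p c] at h
  unfold Ex at h
  obtain ⟨A, hA, hA'⟩ := Finset.exists_le_of_sum_le
    ⟨U, Finset.mem_powerset_self U⟩ h
  refine ⟨A, Finset.mem_powerset.1 hA, ?_⟩
  have : 0 < 1 - p := by linarith
  exact le_of_mul_le_mul_left hA' (by positivity)

open Classical in
theorem Ex_exact {V : Type} (U W S : Finset V) (p : ℝ) (hSW : S ⊆ W) (hWU : W ⊆ U) :
    Ex U p (fun A => if A ∩ W = S then 1 else 0) = p ^ S.card * (1 - p) ^ (W.card - S.card) := by
  unfold Ex
  simp only [mul_ite, mul_one, mul_zero]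
  rw [← Finset.sum_filter]
  have h1 : ∑ A ∈ U.powerset.filter (fun A => A ∩ W = S),
      p ^ A.card * (1 - p) ^ (U.card - A.card) =
      ∑ t ∈ (U \ W).powerset, p ^ S.card * (1 - p) ^ (W.card - S.card) *
        (p ^ t.card * (1 - p) ^ ((U \ W).card - t.card)) := by
    symm
    apply Finset.sum_bij' (fun t _ => S ∪ t) (fun A _ => A \ W)
    · intro t ht
      rw [Finset.mem_powerset] at ht
      rw [Finset.mem_filter, Finset.mem_powerset]
      refine ⟨Finset.union_subset (hSW.trans hWU) (ht.trans Finset.sdiff_subset), ?_⟩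
      ext a
      have h1 := @ht a
      have h2 := @hSW a
      simp only [Finset.mem_inter, Finset.mem_union, Finset.mem_sdiff] at *
      tauto
    · intro A hA
      rw [Finset.mem_filter, Finset.mem_powerset] at hA
      rw [Finset.mem_powerset]
      exact Finset.sdiff_subset_sdiff hA.1 le_rfl
    · intro t ht
      rw [Finset.mem_powerset] at ht
      ext a
      have h1 := @ht a
      have h2 := @hSW a
      simp only [Finset.mem_union, Finset.mem_sdiff] at *
      tauto
    · intro A hA
      rw [Finset.mem_filter, Finset.mem_powerset] at hA
      rw [← hA.2]
      ext a
      simp only [Finset.mem_inter, Finset.mem_union, Finset.mem_sdiff]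
      tauto
    · intro t ht
      rw [Finset.mem_powerset] at ht
      have hd : Disjoint S t := by
        rw [Finset.disjoint_left]
        intro a ha ha'
        exact (Finset.mem_sdiff.1 (ht ha')).2 (hSW ha)
      rw [Finset.card_union_of_disjoint hd]
      have e1 := Finset.card_sdiff_of_subset hWU
      have e2 := Finset.card_le_card ht
      have e3 := Finset.card_le_card hSW
      have e4 := Finset.card_le_card hWU
      have : U.card - (S.card + t.card) = (W.card - S.card) + ((U \ W).card - t.card) := by omega
      rw [this, pow_add, pow_add]
      ring
  rw [h1, ← Finset.mul_sum, Finset.sum_pow_mul_eq_add_pow]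
  simp

open Classical in
theorem Ex_subset {V : Type} (U S : Finset V) (p : ℝ) (hS : S ⊆ U) :
    Ex U p (fun A => if S ⊆ A then 1 else 0) = p ^ S.card := by
  have := Ex_exact U S S p le_rfl hS
  simp only [Nat.sub_self, pow_zero, mul_one] at this
  rw [← this]
  congr 1
  funext A
  simp only [Finset.inter_eq_right]

open Classical in
theorem indep_set {V : Type} (B : Finset V) (R : V → V → Prop) (q : ℝ) (hq0 : 0 < q)
    (hq1 : q < 1) : ∃ I ⊆ B, (∀ u ∈ I, ∀ v ∈ I, u ≠ v → ¬ R u v) ∧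
      q * B.card - q ^ 2 * ((B ×ˢ B).filter (fun t => t.1 ≠ t.2 ∧ R t.1 t.2)).card ≤ I.card := by
  set C := (B ×ˢ B).filter (fun t => t.1 ≠ t.2 ∧ R t.1 t.2) with hC
  have hE : Ex B q (fun A => ∑ v ∈ B, (if {v} ⊆ A then (1 : ℝ) else 0) -
      ∑ t ∈ C, (if ({t.1, t.2} : Finset V) ⊆ A then (1 : ℝ) else 0)) =
      q * B.card - q ^ 2 * C.card := by
    rw [Ex_sub, Ex_sum, Ex_sum]
    congr 1
    · rw [Finset.sum_congr rfl (fun v hv => Ex_subset B {v} q (by simpa using hv))]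
      simp [mul_comm]
    · rw [Finset.sum_congr rfl (g := fun _ => q ^ 2)]
      · simp [mul_comm]
      · intro t ht
        rw [hC, Finset.mem_filter, Finset.mem_product] at ht
        rw [Ex_subset]
        · rw [Finset.card_pair ht.2.1]
        · intro a ha
          simp only [Finset.mem_insert, Finset.mem_singleton] at ha
          rcases ha with rfl | rfl
          · exact ht.1.1
          · exact ht.1.2
  obtain ⟨A, hAB, hA⟩ := Ex_exists B q hq0 hq1 _ _ hE.ge
  refine ⟨A \ (C.filter (fun t => ({t.1, t.2} : Finset V) ⊆ A)).image Prod.fst,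
    Finset.sdiff_subset.trans hAB, ?_, ?_⟩
  · intro u hu v hv huv hR
    rw [Finset.mem_sdiff] at hu hv
    apply hu.2
    rw [Finset.mem_image]
    refine ⟨(u, v), ?_, rfl⟩
    rw [Finset.mem_filter, hC, Finset.mem_filter, Finset.mem_product]
    refine ⟨⟨⟨hAB hu.1, hAB hv.1⟩, huv, hR⟩, ?_⟩
    intro a ha
    simp only [Finset.mem_insert, Finset.mem_singleton] at ha
    rcases ha with rfl | rfl
    · exact hu.1
    · exact hv.1
  · refine hA.trans ?_
    have h1 : ∑ v ∈ B, (if {v} ⊆ A then (1 : ℝ) else 0) = A.card := by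
      simp only [Finset.singleton_subset_iff]
      rw [← Finset.sum_filter, Finset.filter_mem_eq_inter, Finset.inter_eq_right.2 hAB]
      simp
    have h2 : ∑ t ∈ C, (if ({t.1, t.2} : Finset V) ⊆ A then (1 : ℝ) else 0) =
        (C.filter (fun t => ({t.1, t.2} : Finset V) ⊆ A)).card := by
      rw [← Finset.sum_filter]; simp
    rw [h1, h2]
    have h3 := Finset.le_card_sdiff
      ((C.filter (fun t => ({t.1, t.2} : Finset V) ⊆ A)).image Prod.fst) A
    have h4 := Finset.card_image_le (f := Prod.fst)
      (s := C.filter (fun t => ({t.1, t.2} : Finset V) ⊆ A))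
    rw [sub_le_iff_le_add]
    exact_mod_cast (by omega)

open Classical in
theorem finish {V : Type} [Fintype V] (G : SimpleGraph V) (k : ℕ) (X Y : Finset V)
    (hX : ∀ u ∈ X, ∀ v ∈ X, ¬ G.Adj u v) (hY : ∀ u ∈ Y, ∀ v ∈ Y, ¬ G.Adj u v)
    (hdisj : Disjoint X Y) (hdeg : ∀ y ∈ Y, k ≤ (X.filter (fun x => G.Adj y x)).card)
    (hC4 : ∀ y ∈ Y, ∀ y' ∈ Y, ∀ x ∈ X, ∀ x' ∈ X, y ≠ y' → x ≠ x' → G.Adj y x → G.Adj y x' →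
      G.Adj y' x → G.Adj y' x' → False) (hXY : X.card ≤ Y.card) (hne : Y.Nonempty) :
    ∃ t : Finset V, (G.induce (t : Set V)).Colorable 2 ∧
          ¬ HasSubgraphCopy (G.induce (t : Set V)) (cycleGraph 4) ∧
          (k : ℝ) ≤ avgDeg (G.induce (t : Set V)) := by
  refine ⟨X ∪ Y, ?_, ?_, ?_⟩
  · refine ⟨SimpleGraph.Coloring.mk (fun v => if v.1 ∈ X then (0 : Fin 2) else 1) ?_⟩
    rintro ⟨u, hu⟩ ⟨v, hv⟩ huv
    have huv : G.Adj u v := huv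
    have hu : u ∈ X ∪ Y := by exact_mod_cast hu
    have hv : v ∈ X ∪ Y := by exact_mod_cast hv
    rw [Finset.mem_union] at hu hv
    have h1 := hX u
    have h2 := hY u
    by_cases a : u ∈ X <;> by_cases b : v ∈ X
    · exact absurd huv (hX u a v b)
    · simp [a, b]
    · simp [a, b]
    · exact absurd huv (hY u (by tauto) v (by tauto))
  · rintro ⟨f, hf⟩
    have a01 : G.Adj (f 0).1 (f 1).1 := f.map_rel (by decide : (cycleGraph 4).Adj 0 1)
    have a12 : G.Adj (f 1).1 (f 2).1 := f.map_rel (by decide : (cycleGraph 4).Adj 1 2)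
    have a23 : G.Adj (f 2).1 (f 3).1 := f.map_rel (by decide : (cycleGraph 4).Adj 2 3)
    have a30 : G.Adj (f 3).1 (f 0).1 := f.map_rel (by decide : (cycleGraph 4).Adj 3 0)
    have n02 : (f 0).1 ≠ (f 2).1 := fun h => absurd (hf (Subtype.ext h)) (by decide)
    have n13 : (f 1).1 ≠ (f 3).1 := fun h => absurd (hf (Subtype.ext h)) (by decide)
    have hm : ∀ i, (f i).1 ∈ X ∨ (f i).1 ∈ Y := fun i => by
      have : (f i).1 ∈ X ∪ Y := by exact_mod_cast (f i).2
      exact Finset.mem_union.1 this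
    have toY : ∀ i j, G.Adj (f i).1 (f j).1 → (f i).1 ∈ X → (f j).1 ∈ Y := fun i j h hi =>
      (hm j).resolve_left (fun hj => hX _ hi _ hj h)
    have toX : ∀ i j, G.Adj (f i).1 (f j).1 → (f i).1 ∈ Y → (f j).1 ∈ X := fun i j h hi =>
      (hm j).resolve_right (fun hj => hY _ hi _ hj h)
    rcases hm 0 with h0 | h0
    · have h1 := toY _ _ a01 h0
      have h2 := toX _ _ a12 h1
      have h3 := toY _ _ a23 h2
      exact hC4 _ h1 _ h3 _ h0 _ h2 n13 n02 a01.symm a12 a30 a23.symm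
    · have h1 := toX _ _ a01 h0
      have h2 := toY _ _ a12 h1
      have h3 := toX _ _ a23 h2
      exact hC4 _ h0 _ h2 _ h1 _ h3 n02 n13 a01 a30.symm a12.symm a23
  · set t := X ∪ Y with ht
    have hYpos : (0 : ℝ) < Y.card := by exact_mod_cast hne.card_pos
    have hcard : (Fintype.card (↑(t : Set V)) : ℝ) = X.card + Y.card := by
      have : Fintype.card (↑(t : Set V)) = t.card := by simp
      rw [this, ht, Finset.card_union_of_disjoint hdisj]; push_cast; rfl
    set Pr := Y.sigma (fun y => X.filter (fun x => G.Adj y x)) with hPr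
    have hPrc : k * Y.card ≤ Pr.card := by
      rw [hPr, Finset.card_sigma, mul_comm]
      have := Finset.sum_le_sum hdeg
      simpa using this
    have hsub : ((Pr.image (fun z => s(z.1, z.2)) : Finset (Sym2 V)) : Set (Sym2 V)) ⊆
        Set.image (Sym2.map Subtype.val) (G.induce (t : Set V)).edgeSet := by
      intro e he
      rw [Finset.coe_image] at he
      obtain ⟨⟨y, x⟩, hz, rfl⟩ := he
      simp only [hPr, Finset.coe_sigma, Set.mem_sigma_iff, Finset.mem_coe, Finset.mem_filter] at hz
      have hy : y ∈ (t : Set V) := by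
        rw [Finset.mem_coe, ht, Finset.mem_union]; exact Or.inr hz.1
      have hx : x ∈ (t : Set V) := by
        rw [Finset.mem_coe, ht, Finset.mem_union]; exact Or.inl hz.2.1
      refine ⟨s(⟨y, hy⟩, ⟨x, hx⟩), ?_, by simp⟩
      rw [SimpleGraph.mem_edgeSet]
      exact hz.2.2
    have h1 : Pr.card ≤ (G.induce (t : Set V)).edgeSet.ncard := by
      rw [← Set.ncard_image_of_injective _ (Sym2.map.injective Subtype.val_injective)]
      have h2 := Set.ncard_le_ncard hsub (Set.toFinite _)
      rw [Set.ncard_coe_finset, Finset.card_image_of_injOn] at h2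
      · exact h2
      · rintro ⟨y, x⟩ hz ⟨y', x'⟩ hz' h
        simp only [hPr, Finset.coe_sigma, Set.mem_sigma_iff, Finset.mem_coe,
          Finset.mem_filter] at hz hz'
        simp only [Sym2.eq_iff] at h
        rcases h with ⟨rfl, rfl⟩ | ⟨h1, h2⟩
        · rfl
        · exfalso
          rw [h1] at hz
          exact Finset.disjoint_left.1 hdisj hz'.2.1 hz.1
    have h2 : (k : ℝ) * Y.card ≤ (G.induce (t : Set V)).edgeSet.ncard := by
      exact_mod_cast hPrc.trans h1
    have h3 : (X.card : ℝ) ≤ Y.card := by exact_mod_cast hXY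
    have h4 : (k : ℝ) ≤ 2 * (G.induce (t : Set V)).edgeSet.ncard / (X.card + Y.card : ℝ) := by
      rw [le_div_iff₀ (by positivity)]
      have : (0 : ℝ) ≤ k := by positivity
      nlinarith
    unfold avgDeg
    convert h4 using 2

end IndC4

namespace IndC4

open Classical in
/-- vertices with exactly `k` neighbours in `A`, all isolated in `A` -/
noncomputable def BB {V : Type} [Fintype V] (G : SimpleGraph V) (k : ℕ) (A : Finset V) : Finset V :=
  Finset.univ.filter (fun v => (nb G v ∩ A).card = k ∧ ∀ a ∈ nb G v ∩ A, ∀ b ∈ A, ¬ G.Adj a b)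

open Classical in
theorem lower {V : Type} [Fintype V] (G : SimpleGraph V) (s : ℕ) (hs : 0 < s) (hK : KF G s)
    (L : ℝ) (hL : 4 * (s : ℝ) ≤ L) (k : ℕ) (hk : 0 < k) (hLk : 4 * ((k : ℝ) + 1) ≤ L)
    (M g : ℕ) (hg : 1 ≤ g) (hM : 2 * k + 5 ≤ M) (hdeg : ∀ v, ((nb G v).card : ℝ) ≤ L ^ M)
    (v : V) (hv : L ^ M ≤ 2 * L * (nb G v).card) :
    1 / (2 * L ^ ((3 + k + g) * k)) ≤
      Ex Finset.univ (1 / L ^ (M + g)) (fun A => if v ∈ BB G k A then 1 else 0) := by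
  have hs1 : (1 : ℝ) ≤ s := by exact_mod_cast hs
  have hk1 : (1 : ℝ) ≤ k := by exact_mod_cast hk
  have hL0 : 0 < L := by linarith
  have hL1 : 1 ≤ L := by linarith
  set p : ℝ := 1 / L ^ (M + g) with hp
  have hp0 : 0 < p := by positivity
  have hp1 : p ≤ 1 := by
    rw [hp, div_le_one (by positivity)]; exact one_le_pow₀ hL1
  obtain ⟨N, rfl⟩ : ∃ N, M = N + k + 2 := ⟨M - k - 2, by omega⟩
  set z : ℝ := ((nb G v).card : ℝ) with hz
  have hzb : L ^ (N + k) ≤ z := by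
    have h1 : L ^ 2 * L ^ (N + k) ≤ L ^ 2 * z := by
      rw [← pow_add, add_comm 2]
      refine hv.trans ?_
      have h0 : 0 ≤ z := by positivity
      have h2 : 2 * L ≤ L ^ 2 := by nlinarith
      exact mul_le_mul_of_nonneg_right h2 h0
    exact le_of_mul_le_mul_left h1 (by positivity)
  have hind := indep_count G s hs hK L hL k (by linarith) (fun _ => nb G v) z (fun _ => le_rfl) (by
    exact le_trans (pow_le_pow_right₀ hL1 (by omega)) hzb)
  set I := (Finset.univ.filter (fun y : Fin k → V => (∀ i, y i ∈ nb G v) ∧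
      Function.Injective y ∧ ∀ i j, ¬ G.Adj (y i) (y j))) with hI
  set S : (Fin k → V) → Finset V := fun x => Finset.univ.image x with hS
  set W : (Fin k → V) → Finset V := fun x => nb G v ∪ (S x).biUnion (nb G) with hW
  have hSW : ∀ x ∈ I, S x ⊆ nb G v := by
    intro x hx a ha
    simp only [hI, Finset.mem_filter, Finset.mem_univ, true_and] at hx
    simp only [hS, Finset.mem_image, Finset.mem_univ, true_and] at ha
    obtain ⟨i, rfl⟩ := ha
    exact hx.1 i
  have hSc : ∀ x ∈ I, (S x).card = k := by
    intro x hx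
    simp only [hI, Finset.mem_filter, Finset.mem_univ, true_and] at hx
    rw [hS]
    simp only
    rw [Finset.card_image_of_injective _ hx.2.1]
    simp
  have hWc : ∀ x ∈ I, ((W x).card : ℝ) ≤ (k + 1) * L ^ (N + k + 2) := by
    intro x hx
    have h1 : (W x).card ≤ (nb G v).card + ∑ a ∈ S x, (nb G a).card :=
      (Finset.card_union_le _ _).trans (Nat.add_le_add_left Finset.card_biUnion_le _)
    have h2 : ((W x).card : ℝ) ≤ (nb G v).card + ∑ a ∈ S x, ((nb G a).card : ℝ) := by
      exact_mod_cast h1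
    have h3 : ∑ a ∈ S x, ((nb G a).card : ℝ) ≤ ∑ a ∈ S x, L ^ (N + k + 2) :=
      Finset.sum_le_sum (fun a _ => hdeg a)
    rw [Finset.sum_const, hSc x hx, nsmul_eq_mul] at h3
    have h4 := hdeg v
    linarith
  have hEx : ∀ x ∈ I, p ^ k / 2 ≤ Ex Finset.univ p (fun A => if A ∩ W x = S x then 1 else 0) := by
    intro x hx
    rw [Ex_exact _ _ _ _ ((hSW x hx).trans Finset.subset_union_left) (Finset.subset_univ _), hSc x hx]
    have h1 : (1 - p) ^ (W x).card ≤ (1 - p) ^ ((W x).card - k) :=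
      pow_le_pow_of_le_one (by linarith) (by linarith) (Nat.sub_le _ _)
    have h2 := one_add_mul_le_pow (a := -p) (by linarith) (W x).card
    have h3 : ((W x).card : ℝ) * p ≤ 1 / 2 := by
      have h4 : ((W x).card : ℝ) * p ≤ (k + 1) * L ^ (N + k + 2) * p :=
        mul_le_mul_of_nonneg_right (hWc x hx) hp0.le
      refine h4.trans ?_
      rw [hp, pow_add L (N + k + 2) g, mul_one_div, div_le_iff₀ (by positivity)]
      have h5 : L ≤ L ^ g := by
        have := pow_le_pow_right₀ hL1 hg
        simpa using this
      have h6 : (0 : ℝ) < L ^ (N + k + 2) := by positivity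
      nlinarith
    have h7 : 1 / 2 ≤ (1 - p) ^ ((W x).card - k) := by
      refine le_trans ?_ h1
      have : 1 + -p = 1 - p := by ring
      rw [this] at h2
      linarith
    have h8 : 0 < p ^ k := by positivity
    nlinarith
  have hup : ∀ A : Finset V, ∑ x ∈ I, (if A ∩ W x = S x then (1 : ℝ) else 0) ≤
      (k : ℝ) ^ k * (if v ∈ BB G k A then 1 else 0) := by
    intro A
    rw [← Finset.sum_filter]
    simp only [Finset.sum_const, nsmul_eq_mul, mul_one]
    have key : ∀ x ∈ I.filter (fun x => A ∩ W x = S x), nb G v ∩ A = S x := by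
      intro x hx
      rw [Finset.mem_filter] at hx
      have h1 := hSW x hx.1
      ext a
      constructor
      · intro ha
        rw [Finset.mem_inter] at ha
        rw [← hx.2, Finset.mem_inter]
        exact ⟨ha.2, Finset.mem_union_left _ ha.1⟩
      · intro ha
        rw [Finset.mem_inter]
        refine ⟨h1 ha, ?_⟩
        rw [← hx.2] at ha
        exact (Finset.mem_inter.1 ha).1
    rcases Finset.eq_empty_or_nonempty (I.filter (fun x => A ∩ W x = S x)) with h0 | ⟨x0, hx0⟩
    · rw [h0]; simp
      split_ifs <;> positivity
    · have hx0' := Finset.mem_filter.1 hx0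
      have hm : v ∈ BB G k A := by
        rw [BB, Finset.mem_filter]
        refine ⟨Finset.mem_univ _, ?_, ?_⟩
        · rw [key x0 hx0, hSc x0 hx0'.1]
        · rw [key x0 hx0]
          intro a ha b hb hab
          have hbW : b ∈ A ∩ W x0 := by
            rw [Finset.mem_inter]
            refine ⟨hb, Finset.mem_union_right _ (Finset.mem_biUnion.2 ⟨a, ha, ?_⟩)⟩
            rw [mem_nb]; exact hab
          rw [hx0'.2] at hbW
          simp only [hS, Finset.mem_image, Finset.mem_univ, true_and] at ha hbW
          obtain ⟨i, rfl⟩ := ha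
          obtain ⟨j, rfl⟩ := hbW
          have := hx0'.1
          simp only [hI, Finset.mem_filter, Finset.mem_univ, true_and] at this
          exact this.2.2 i j hab
      rw [if_pos hm, mul_one]
      have hsub : I.filter (fun x => A ∩ W x = S x) ⊆
          Fintype.piFinset (fun _ : Fin k => nb G v ∩ A) := by
        intro x hx
        rw [Fintype.mem_piFinset]
        intro i
        rw [key x hx]
        exact Finset.mem_image_of_mem _ (Finset.mem_univ _)
      have h2 := Finset.card_le_card hsub
      rw [Fintype.card_piFinset_const, key x0 hx0, hSc x0 hx0'.1] at h2
      exact_mod_cast h2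
  have h1 := Ex_mono Finset.univ p hp0.le hp1 _ _ (fun A _ => hup A)
  rw [Ex_sum, Ex_mul] at h1
  have h2 := Finset.sum_le_sum hEx
  rw [Finset.sum_const, nsmul_eq_mul] at h2
  have h3 : (L ^ N) ^ k ≤ I.card := by
    refine le_trans ?_ hind
    apply pow_le_pow_left₀ (by positivity)
    rw [le_div_iff₀ (by positivity), ← pow_add]
    exact hzb
  set E := Ex Finset.univ p (fun A => if v ∈ BB G k A then (1 : ℝ) else 0) with hE
  have h4 : (L ^ N) ^ k * (p ^ k / 2) ≤ (k : ℝ) ^ k * E := by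
    refine le_trans ?_ (h2.trans h1)
    gcongr
  have hkk : (0 : ℝ) < (k : ℝ) ^ k := by positivity
  have h5 : (k : ℝ) ^ k * (1 / (2 * L ^ ((3 + k + g) * k))) ≤ (k : ℝ) ^ k * E := by
    refine le_trans ?_ h4
    have h6 : (k : ℝ) ^ k ≤ L ^ k := pow_le_pow_left₀ (by positivity) (by linarith) _
    have h7 : (L ^ N) ^ k * (p ^ k / 2) = L ^ k * (1 / (2 * L ^ ((3 + k + g) * k))) := by
      rw [hp, div_pow, one_pow, ← pow_mul, ← pow_mul]
      have : (L ^ (N * k) * L ^ ((3 + k + g) * k)) = L ^ k * L ^ ((N + k + 2 + g) * k) := by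
        rw [← pow_add, ← pow_add]; congr 1; ring
      field_simp
      linarith
    rw [h7]
    gcongr
  exact le_of_mul_le_mul_left h5 hkk

end IndC4

namespace IndC4

open Classical in
theorem pair {V : Type} [Fintype V] (G : SimpleGraph V)
    (L : ℝ) (hL1 : 1 ≤ L) (k : ℕ)
    (M g : ℕ) (hdeg : ∀ v, ((nb G v).card : ℝ) ≤ L ^ M) (u v : V) :
    Ex Finset.univ (1 / L ^ (M + g)) (fun A => if (u ∈ BB G k A ∧ v ∈ BB G k A) ∧
      (G.Adj u v ∨ 2 ≤ ((nb G u ∩ nb G v) ∩ A).card) then 1 else 0) ≤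
    (if L ^ M ≤ L ^ (2 * k * g) * (nb G u ∩ nb G v).card then 1 else 0) +
    (if G.Adj u v then 2 / L ^ (2 * k * g) else 0) +
    (nb G u ∩ nb G v).card / (L ^ M * L ^ (2 * k * g)) := by
  have hL0 : 0 < L := by linarith
  set p : ℝ := 1 / L ^ (M + g) with hp
  have hp0 : 0 < p := by positivity
  have hp1 : p ≤ 1 := by
    rw [hp, div_le_one (by positivity)]; exact one_le_pow₀ hL1
  set e := 2 * k * g with he
  set C := nb G u ∩ nb G v with hC
  have hadj0 : (0 : ℝ) ≤ (if G.Adj u v then 2 / L ^ e else 0) := by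
    split_ifs <;> positivity
  have hc0 : (0 : ℝ) ≤ (C.card : ℝ) / (L ^ M * L ^ e) := by positivity
  by_cases hh : L ^ M ≤ L ^ e * C.card
  · rw [if_pos hh]
    have h1 := Ex_mono Finset.univ p hp0.le hp1 (fun A => if (u ∈ BB G k A ∧ v ∈ BB G k A) ∧
      (G.Adj u v ∨ 2 ≤ (C ∩ A).card) then (1 : ℝ) else 0) (fun _ => 1) (by
        intro A _
        split_ifs <;> norm_num)
    rw [Ex_const] at h1
    linarith
  · rw [if_neg hh, zero_add]
    push Not at hh
    have hcp : (C.card : ℝ) * p ≤ 1 / L ^ e := by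
      rw [hp, mul_one_div, div_le_div_iff₀ (by positivity) (by positivity)]
      have : L ^ M ≤ L ^ (M + g) := pow_le_pow_right₀ hL1 (by omega)
      linarith
    by_cases ha : G.Adj u v
    · rw [if_pos ha]
      set PS : V → Finset (Finset V) := fun w => (nb G w).powersetCard k with hPS
      set D := ((PS u) ×ˢ (PS v)).filter (fun t => Disjoint t.1 t.2) with hD
      have hpt : ∀ A : Finset V, A ⊆ Finset.univ → (if (u ∈ BB G k A ∧ v ∈ BB G k A) ∧
          (G.Adj u v ∨ 2 ≤ (C ∩ A).card) then (1 : ℝ) else 0) ≤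
          ∑ t ∈ D, (if t.1 ∪ t.2 ⊆ A then (1 : ℝ) else 0) +
          ∑ a ∈ C, (if {a} ⊆ A then (1 : ℝ) else 0) := by
        intro A _
        have n1 : ∀ t ∈ D, (0 : ℝ) ≤ (if t.1 ∪ t.2 ⊆ A then (1 : ℝ) else 0) := by
          intro t _; split_ifs <;> norm_num
        have n2 : ∀ a ∈ C, (0 : ℝ) ≤ (if {a} ⊆ A then (1 : ℝ) else 0) := by
          intro t _; split_ifs <;> norm_num
        have s1 := Finset.sum_nonneg n1
        have s2 := Finset.sum_nonneg n2
        split_ifs with hE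
        · obtain ⟨⟨hu, hv⟩, _⟩ := hE
          rw [BB, Finset.mem_filter] at hu hv
          by_cases hJ : ∃ a ∈ C, a ∈ A
          · obtain ⟨a, haC, haA⟩ := hJ
            have := Finset.single_le_sum n2 haC
            rw [if_pos (by simpa using haA)] at this
            linarith
          · have hmem : (nb G u ∩ A, nb G v ∩ A) ∈ D := by
              rw [hD, Finset.mem_filter, Finset.mem_product, hPS]
              simp only [Finset.mem_powersetCard]
              refine ⟨⟨⟨Finset.inter_subset_left, hu.2.1⟩, ⟨Finset.inter_subset_left, hv.2.1⟩⟩, ?_⟩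
              rw [Finset.disjoint_left]
              intro a h1 h2
              rw [Finset.mem_inter] at h1 h2
              exact hJ ⟨a, Finset.mem_inter.2 ⟨h1.1, h2.1⟩, h1.2⟩
            have := Finset.single_le_sum n1 hmem
            rw [if_pos (Finset.union_subset Finset.inter_subset_right
              Finset.inter_subset_right)] at this
            linarith
        · linarith
      have h1 := Ex_mono Finset.univ p hp0.le hp1 _ _ hpt
      rw [Ex_add, Ex_sum, Ex_sum] at h1
      have h2 : ∑ t ∈ D, Ex Finset.univ p (fun A => if t.1 ∪ t.2 ⊆ A then (1 : ℝ) else 0)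
          ≤ 1 / L ^ e := by
        rw [Finset.sum_congr rfl (g := fun _ => p ^ (2 * k))]
        · rw [Finset.sum_const, nsmul_eq_mul]
          have hDc : (D.card : ℝ) ≤ (L ^ M) ^ k * (L ^ M) ^ k := by
            have h3 : D.card ≤ (nb G u).card ^ k * (nb G v).card ^ k := by
              refine (Finset.card_le_card (Finset.filter_subset _ _)).trans ?_
              rw [Finset.card_product, hPS]
              simp only [Finset.card_powersetCard]
              exact Nat.mul_le_mul (Nat.choose_le_pow _ _) (Nat.choose_le_pow _ _)
            have h4 : (D.card : ℝ) ≤ ((nb G u).card : ℝ) ^ k * ((nb G v).card : ℝ) ^ k := by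
              exact_mod_cast h3
            refine h4.trans ?_
            have := hdeg u
            have := hdeg v
            gcongr <;> apply hdeg
          refine (mul_le_mul_of_nonneg_right hDc (by positivity)).trans (le_of_eq ?_)
          rw [hp, he, div_pow, one_pow, mul_one_div, div_eq_div_iff (by positivity) (by positivity),
            ← pow_mul, ← pow_mul, ← pow_add, ← pow_add, one_mul]
          congr 1; ring
        · intro t ht
          rw [hD, Finset.mem_filter, Finset.mem_product, hPS] at ht
          simp only [Finset.mem_powersetCard] at ht
          rw [Ex_subset _ _ _ (Finset.subset_univ _), Finset.card_union_of_disjoint ht.2,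
            ht.1.1.2, ht.1.2.2, two_mul]
      have h3 : ∑ a ∈ C, Ex Finset.univ p (fun A => if {a} ⊆ A then (1 : ℝ) else 0)
          ≤ 1 / L ^ e := by
        rw [Finset.sum_congr rfl (fun a _ => Ex_subset _ _ _ (Finset.subset_univ _))]
        simpa using hcp
      have h4 : 2 / L ^ e = 1 / L ^ e + 1 / L ^ e := by ring
      linarith
    · rw [if_neg ha, zero_add]
      have hpt : ∀ A : Finset V, A ⊆ Finset.univ → (if (u ∈ BB G k A ∧ v ∈ BB G k A) ∧
          (G.Adj u v ∨ 2 ≤ (C ∩ A).card) then (1 : ℝ) else 0) ≤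
          ∑ t ∈ C.offDiag, (if {t.1, t.2} ⊆ A then (1 : ℝ) else 0) := by
        intro A _
        have n1 : ∀ t ∈ C.offDiag, (0 : ℝ) ≤ (if {t.1, t.2} ⊆ A then (1 : ℝ) else 0) := by
          intro t _; split_ifs <;> norm_num
        split_ifs with hE
        · have h2 : 1 < (C ∩ A).card := hE.2.resolve_left ha
          obtain ⟨a, haC, b, hbC, hab⟩ := Finset.one_lt_card.1 h2
          rw [Finset.mem_inter] at haC hbC
          have hmem : (a, b) ∈ C.offDiag := Finset.mem_offDiag.2 ⟨haC.1, hbC.1, hab⟩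
          have := Finset.single_le_sum n1 hmem
          rw [if_pos] at this
          · exact this
          · intro c hc
            simp only [Finset.mem_insert, Finset.mem_singleton] at hc
            rcases hc with rfl | rfl
            · exact haC.2
            · exact hbC.2
        · exact Finset.sum_nonneg n1
      have h1 := Ex_mono Finset.univ p hp0.le hp1 _ _ hpt
      rw [Ex_sum] at h1
      refine h1.trans ?_
      rw [Finset.sum_congr rfl (g := fun _ => p ^ 2)]
      · rw [Finset.sum_const, nsmul_eq_mul]
        have h2 : (C.offDiag.card : ℝ) ≤ (C.card : ℝ) * C.card := by
          have : C.offDiag.card ≤ C.card * C.card := by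
            rw [Finset.offDiag_card]; exact Nat.sub_le _ _
          exact_mod_cast this
        have h3 : p ≤ 1 / L ^ M := by
          rw [hp]
          apply one_div_le_one_div_of_le (by positivity)
          exact pow_le_pow_right₀ hL1 (by omega)
        calc (C.offDiag.card : ℝ) * p ^ 2 ≤ (C.card : ℝ) * C.card * p ^ 2 := by gcongr
          _ = C.card * p * (C.card * p) := by ring
          _ ≤ C.card * (1 / L ^ M) * (1 / L ^ e) := by gcongr
          _ = C.card / (L ^ M * L ^ e) := by field_simp
      · intro t ht
        rw [Finset.mem_offDiag] at ht
        rw [Ex_subset _ _ _ (Finset.subset_univ _), Finset.card_pair ht.2.2]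

open Classical in
theorem sum_codeg {V : Type} [Fintype V] (G : SimpleGraph V) (D : ℝ) (hD : 0 ≤ D)
    (hdeg : ∀ v, ((nb G v).card : ℝ) ≤ D) (u : V) :
    ∑ v, ((nb G u ∩ nb G v).card : ℝ) ≤ D * D := by
  have h := Finset.sum_card_bipartiteAbove_eq_sum_card_bipartiteBelow
    (fun (v a : V) => G.Adj v a) (s := Finset.univ) (t := nb G u)
  have h1 : ∑ v, (nb G u ∩ nb G v).card = ∑ a ∈ nb G u, (nb G a).card := by
    calc ∑ v, (nb G u ∩ nb G v).card
        = ∑ v, (Finset.bipartiteAbove (fun (v a : V) => G.Adj v a) (nb G u) v).card := by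
          apply Finset.sum_congr rfl
          intro v _
          congr 1
          ext a
          simp [Finset.bipartiteAbove, mem_nb]
      _ = _ := h
      _ = _ := by
          apply Finset.sum_congr rfl
          intro a _
          congr 1
          ext v
          simp [Finset.bipartiteBelow, mem_nb, G.adj_comm]
  have h2 : ∑ v, ((nb G u ∩ nb G v).card : ℝ) = ∑ a ∈ nb G u, ((nb G a).card : ℝ) := by
    exact_mod_cast h1
  rw [h2]
  refine (Finset.sum_le_sum (fun a _ => hdeg a)).trans ?_
  rw [Finset.sum_const, nsmul_eq_mul]
  exact mul_le_mul_of_nonneg_right (hdeg u) hD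

end IndC4

namespace IndC4

open Classical in
theorem sparse {V : Type} [Fintype V] (G : SimpleGraph V) (s : ℕ) (hs : 0 < s) (hK : KF G s)
    (L : ℝ) (hL : 4 * (s : ℝ) ≤ L) (k : ℕ) (hk : 0 < k) (hLk : 4 * ((k : ℝ) + 1) ≤ L)
    (r g M : ℕ) (hr : r = 2 + (3 + k) * k) (hg : g = 2 * (r + 1)) (hM : 2 * k + 5 ≤ M)
    (hM2 : k * g < M) (hdeg : ∀ v, ((nb G v).card : ℝ) ≤ L ^ M)
    (hn : 0 < Fintype.card V)
    (havg : (Fintype.card V : ℝ) * L ^ M ≤ L * ∑ v, ((nb G v).card : ℝ))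
    (hheavy : ∀ u, L ^ (2 * k * g) * ((Finset.univ.filter (fun v =>
      L ^ M ≤ L ^ (2 * k * g) * ((nb G u ∩ nb G v).card : ℝ))).card : ℝ) ≤ L ^ M) :
    ∃ t : Finset V, (G.induce (t : Set V)).Colorable 2 ∧
          ¬ HasSubgraphCopy (G.induce (t : Set V)) (cycleGraph 4) ∧
          (k : ℝ) ≤ avgDeg (G.induce (t : Set V)) := by
  have hk1 : (1 : ℝ) ≤ k := by exact_mod_cast hk
  have hL8 : 8 ≤ L := by linarith
  have hL0 : 0 < L := by linarith
  have hL1 : 1 ≤ L := by linarith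
  set n : ℝ := (Fintype.card V : ℝ) with hnd
  have hn0 : 0 < n := by rw [hnd]; exact_mod_cast hn
  set p : ℝ := 1 / L ^ (M + g) with hp
  have hp0 : 0 < p := by positivity
  have hp1 : p < 1 := by
    rw [hp, div_lt_one (by positivity)]
    exact one_lt_pow₀ (by linarith) (by omega)
  set q : ℝ := L ^ (k * g) / L ^ (M + r + 1) with hq
  have hq0 : 0 < q := by positivity
  have hq1 : q < 1 := by
    rw [hq, div_lt_one (by positivity)]
    exact pow_lt_pow_right₀ (by linarith) (by omega)
  set e := 2 * k * g with he
  -- high degree vertices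
  set S := Finset.univ.filter (fun v : V => L ^ M ≤ 2 * L * ((nb G v).card : ℝ)) with hS
  have hSn : n ≤ 2 * L * S.card := by
    have h1 : ∑ v, L * ((nb G v).card : ℝ) ≤
        ∑ v : V, (L ^ M / 2 + L * L ^ M * (if v ∈ S then (1 : ℝ) else 0)) := by
      apply Finset.sum_le_sum
      intro v _
      have hpos : 0 < L ^ M := by positivity
      by_cases hv : v ∈ S
      · rw [if_pos hv]
        have := mul_le_mul_of_nonneg_left (hdeg v) hL0.le
        linarith
      · rw [if_neg hv]
        rw [hS, Finset.mem_filter] at hv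
        have : ¬ (L ^ M ≤ 2 * L * ((nb G v).card : ℝ)) := fun h => hv ⟨Finset.mem_univ _, h⟩
        push Not at this
        linarith
    rw [← Finset.mul_sum, Finset.sum_add_distrib, ← Finset.mul_sum, Finset.sum_const,
      Finset.sum_boole, nsmul_eq_mul, Finset.card_univ, ← hnd, Finset.filter_univ_mem] at h1
    have h2 : L ^ M * n ≤ L ^ M * (2 * L * S.card) := by linarith
    exact le_of_mul_le_mul_left h2 (by positivity)
  have hEB : n / L ^ (r + k * g) ≤
      ∑ v, Ex Finset.univ p (fun A => if v ∈ BB G k A then (1 : ℝ) else 0) := by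
    have h0 : ∀ v, 0 ≤ Ex Finset.univ p (fun A => if v ∈ BB G k A then (1 : ℝ) else 0) := by
      intro v
      have := Ex_mono Finset.univ p hp0.le hp1.le (fun _ => 0)
        (fun A => if v ∈ BB G k A then (1 : ℝ) else 0) (by
          intro A _; split_ifs <;> norm_num)
      rwa [Ex_const] at this
    have h1 : ∑ v ∈ S, 1 / (2 * L ^ ((3 + k + g) * k)) ≤
        ∑ v ∈ S, Ex Finset.univ p (fun A => if v ∈ BB G k A then (1 : ℝ) else 0) := by
      apply Finset.sum_le_sum
      intro v hv
      rw [hS, Finset.mem_filter] at hv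
      exact lower G s hs hK L hL k hk hLk M g (by omega) hM hdeg v hv.2
    have h2 := Finset.sum_le_sum_of_subset_of_nonneg (Finset.subset_univ S)
      (fun v _ _ => h0 v)
    refine le_trans ?_ (h1.trans h2)
    rw [Finset.sum_const, nsmul_eq_mul, mul_one_div]
    have h3 : r + k * g = (3 + k + g) * k + 2 := by rw [hr]; ring
    rw [h3, div_le_div_iff₀ (by positivity) (by positivity), pow_add]
    have hc : (0 : ℝ) ≤ S.card := by positivity
    have h4 : n * 2 ≤ S.card * L ^ 2 := by nlinarith
    have hP : 0 < L ^ ((3 + k + g) * k) := by positivity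
    nlinarith
  -- conflicts
  have hEC : ∑ u, ∑ v, Ex Finset.univ p (fun A => if (u ∈ BB G k A ∧ v ∈ BB G k A) ∧
      (G.Adj u v ∨ 2 ≤ ((nb G u ∩ nb G v) ∩ A).card) then (1 : ℝ) else 0) ≤
      n * (4 * (L ^ M / L ^ e)) := by
    have h1 : ∀ u ∈ (Finset.univ : Finset V),
        ∑ v, Ex Finset.univ p (fun A => if (u ∈ BB G k A ∧ v ∈ BB G k A) ∧
      (G.Adj u v ∨ 2 ≤ ((nb G u ∩ nb G v) ∩ A).card) then (1 : ℝ) else 0) ≤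
      4 * (L ^ M / L ^ e) := by
      intro u _
      refine (Finset.sum_le_sum (fun v _ => pair G L hL1 k M g hdeg u v)).trans ?_
      rw [Finset.sum_add_distrib, Finset.sum_add_distrib, Finset.sum_boole, ← Finset.sum_div]
      have a1 : ((Finset.univ.filter (fun v =>
          L ^ M ≤ L ^ e * ((nb G u ∩ nb G v).card : ℝ))).card : ℝ) ≤ L ^ M / L ^ e := by
        rw [le_div_iff₀ (by positivity), mul_comm]
        exact hheavy u
      have a2 : ∑ v, (if G.Adj u v then 2 / L ^ e else 0) ≤ 2 * (L ^ M / L ^ e) := by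
        rw [← Finset.sum_filter, Finset.sum_const, nsmul_eq_mul]
        have := hdeg u
        rw [nb] at this
        calc _ ≤ L ^ M * (2 / L ^ e) := by gcongr
          _ = _ := by ring
      have a3 : (∑ v, ((nb G u ∩ nb G v).card : ℝ)) / (L ^ M * L ^ e) ≤ L ^ M / L ^ e := by
        have := sum_codeg G (L ^ M) (by positivity) hdeg u
        calc _ ≤ L ^ M * L ^ M / (L ^ M * L ^ e) := by gcongr
          _ = _ := by field_simp
      linarith
    refine (Finset.sum_le_sum h1).trans ?_
    rw [Finset.sum_const, nsmul_eq_mul, Finset.card_univ]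
  have hEA : ∑ v : V, Ex Finset.univ p (fun A => if {v} ⊆ A then (1 : ℝ) else 0) = n * p := by
    rw [Finset.sum_congr rfl (fun a _ => Ex_subset _ _ _ (Finset.subset_univ _))]
    simp [hnd]
  set c : ℝ := n / L ^ (M + 2 * r + 1) - 5 * (n / L ^ (M + 2 * r + 2)) with hc
  have hc0 : 0 < c := by
    have : n / L ^ (M + 2 * r + 1) = L * (n / L ^ (M + 2 * r + 2)) := by
      rw [pow_succ L (M + 2 * r + 1)]; field_simp
    rw [hc, this]
    have : 0 < n / L ^ (M + 2 * r + 2) := by positivity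
    nlinarith
  have hmain : c ≤ Ex Finset.univ p (fun A =>
      (q * (∑ v, (if v ∈ BB G k A then (1 : ℝ) else 0)) -
      q ^ 2 * (∑ u, ∑ v, (if (u ∈ BB G k A ∧ v ∈ BB G k A) ∧
      (G.Adj u v ∨ 2 ≤ ((nb G u ∩ nb G v) ∩ A).card) then (1 : ℝ) else 0))) -
      ∑ v : V, (if {v} ⊆ A then (1 : ℝ) else 0)) := by
    rw [Ex_sub, Ex_sub, Ex_mul, Ex_mul, Ex_sum, Ex_sum, Ex_sum, hEA]
    simp_rw [Ex_sum]
    have b1 := mul_le_mul_of_nonneg_left hEB hq0.le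
    have b2 := mul_le_mul_of_nonneg_left hEC (sq_nonneg q)
    have b3 : q * (n / L ^ (r + k * g)) = n / L ^ (M + 2 * r + 1) := by
      rw [hq, div_mul_div_comm, div_eq_div_iff (by positivity) (by positivity)]
      ring
    have b4 : q ^ 2 * (n * (4 * (L ^ M / L ^ e))) = 4 * (n / L ^ (M + 2 * r + 2)) := by
      have : L ^ e = L ^ (k * g) * L ^ (k * g) := by rw [← pow_add, he]; congr 1; ring
      rw [hq, this]
      have : L ^ (M + r + 1) ^ 1 * L ^ (M + r + 1) = L ^ M * L ^ (M + 2 * r + 2) := by ring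
      field_simp
      ring
    have b5 : n * p = n / L ^ (M + 2 * r + 2) := by
      rw [hp, mul_one_div]; congr 2; omega
    rw [b3] at b1
    rw [b4] at b2
    rw [b5, hc]
    linarith
  obtain ⟨A, -, hA⟩ := Ex_exists Finset.univ p hp0 hp1 _ c hmain
  obtain ⟨Y, hYB, hYR, hYc⟩ := indep_set (BB G k A)
    (fun u v => G.Adj u v ∨ 2 ≤ ((nb G u ∩ nb G v) ∩ A).card) q hq0 hq1
  have k1 : ∑ v, (if v ∈ BB G k A then (1 : ℝ) else 0) = (BB G k A).card := by
    rw [Finset.sum_boole, Finset.filter_univ_mem]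
  have k2 : ∑ v : V, (if {v} ⊆ A then (1 : ℝ) else 0) = A.card := by
    simp_rw [Finset.singleton_subset_iff]
    rw [Finset.sum_boole, Finset.filter_univ_mem]
  have k3 : ((((BB G k A) ×ˢ (BB G k A)).filter (fun t => t.1 ≠ t.2 ∧
      (G.Adj t.1 t.2 ∨ 2 ≤ ((nb G t.1 ∩ nb G t.2) ∩ A).card))).card : ℝ) ≤
      ∑ u, ∑ v, (if (u ∈ BB G k A ∧ v ∈ BB G k A) ∧
      (G.Adj u v ∨ 2 ≤ ((nb G u ∩ nb G v) ∩ A).card) then (1 : ℝ) else 0) := by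
    rw [← Finset.sum_product', Finset.sum_boole]
    have : (((BB G k A) ×ˢ (BB G k A)).filter (fun t => t.1 ≠ t.2 ∧
      (G.Adj t.1 t.2 ∨ 2 ≤ ((nb G t.1 ∩ nb G t.2) ∩ A).card))) ⊆
      (Finset.univ ×ˢ Finset.univ).filter (fun t : V × V => (t.1 ∈ BB G k A ∧ t.2 ∈ BB G k A) ∧
      (G.Adj t.1 t.2 ∨ 2 ≤ ((nb G t.1 ∩ nb G t.2) ∩ A).card)) := by
      intro t ht
      rw [Finset.mem_filter, Finset.mem_product] at ht ⊢
      exact ⟨by simp, ht.1, ht.2.2⟩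
    exact_mod_cast Finset.card_le_card this
  have hYA : (A.card : ℝ) < Y.card := by
    rw [k1, k2] at hA
    have := mul_le_mul_of_nonneg_left k3 (sq_nonneg q)
    have hYc' : q * (BB G k A).card - q ^ 2 * ((((BB G k A) ×ˢ (BB G k A)).filter (fun t =>
        t.1 ≠ t.2 ∧ (G.Adj t.1 t.2 ∨ 2 ≤ ((nb G t.1 ∩ nb G t.2) ∩ A).card))).card : ℝ) ≤
        Y.card := by
      convert hYc
    linarith
  have hYA' : A.card < Y.card := by exact_mod_cast hYA
  have hBm : ∀ y ∈ Y, (nb G y ∩ A).card = k ∧ ∀ a ∈ nb G y ∩ A, ∀ b ∈ A, ¬ G.Adj a b := by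
    intro y hy
    have := hYB hy
    rw [BB, Finset.mem_filter] at this
    exact this.2
  refine finish G k (A.filter (fun a => ∀ b ∈ A, ¬ G.Adj a b)) Y ?_ ?_ ?_ ?_ ?_ ?_ ?_
  · intro u hu v hv
    rw [Finset.mem_filter] at hu hv
    exact hu.2 v hv.1
  · intro u hu v hv huv
    exact hYR u hu v hv huv.ne (Or.inl huv)
  · rw [Finset.disjoint_left]
    intro a ha hy
    rw [Finset.mem_filter] at ha
    have h1 := hBm a hy
    have h2 : (nb G a ∩ A).Nonempty := by
      rw [← Finset.card_pos]; omega
    obtain ⟨b, hb⟩ := h2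
    rw [Finset.mem_inter, mem_nb] at hb
    exact ha.2 b hb.2 hb.1
  · intro y hy
    have h1 := hBm y hy
    rw [← h1.1]
    apply Finset.card_le_card
    intro a ha
    have h2 := h1.2 a ha
    rw [Finset.mem_inter, mem_nb] at ha
    rw [Finset.mem_filter, Finset.mem_filter]
    exact ⟨⟨ha.2, h2⟩, ha.1⟩
  · intro y hy y' hy' x hx x' hx' hyy hxx h1 h2 h3 h4
    rw [Finset.mem_filter] at hx hx'
    apply hYR y hy y' hy' hyy
    right
    apply Finset.one_lt_card.2
    refine ⟨x, ?_, x', ?_, hxx⟩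
    · rw [Finset.mem_inter, Finset.mem_inter, mem_nb, mem_nb]; exact ⟨⟨h1, h3⟩, hx.1⟩
    · rw [Finset.mem_inter, Finset.mem_inter, mem_nb, mem_nb]; exact ⟨⟨h2, h4⟩, hx'.1⟩
  · exact (Finset.card_le_card (Finset.filter_subset _ _)).trans hYA'.le
  · rw [← Finset.card_pos]; omega

end IndC4

namespace IndC4

/-- point-line incidence of the affine plane -/
theorem plane (k : ℕ) : ∃ (h : ℕ) (H : Fin h → Fin h → Prop), 2 ≤ h ∧
    (∀ j, ∃ S : Finset (Fin h), k ≤ S.card ∧ ∀ i ∈ S, H i j) ∧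
    (∀ i i' j j', i ≠ i' → j ≠ j' → H i j → H i' j → H i j' → H i' j' → False) := by
  obtain ⟨l, hl, hp⟩ := Nat.exists_infinite_primes (k + 2)
  haveI : Fact l.Prime := ⟨hp⟩
  have hcard : Fintype.card (ZMod l × ZMod l) = l * l := by
    rw [Fintype.card_prod, ZMod.card]
  let φ : Fin (l * l) ≃ ZMod l × ZMod l := (Fintype.equivFinOfCardEq hcard).symm
  refine ⟨l * l, fun i j => (φ i).2 = (φ j).1 * (φ i).1 + (φ j).2, by nlinarith, ?_, ?_⟩
  · intro j
    refine ⟨Finset.univ.image (fun a : ZMod l => φ.symm (a, (φ j).1 * a + (φ j).2)), ?_, ?_⟩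
    · rw [Finset.card_image_of_injective, Finset.card_univ, ZMod.card]
      · omega
      · intro a b hab
        have := φ.symm.injective hab
        exact (Prod.ext_iff.1 this).1
    · intro i hi
      rw [Finset.mem_image] at hi
      obtain ⟨a, -, rfl⟩ := hi
      simp
  · intro i i' j j' hi hj h1 h2 h3 h4
    have e1 : ((φ j).1 - (φ j').1) * ((φ i).1 - (φ i').1) = 0 := by
      linear_combination h2 + h3 - h1 - h4
    rcases mul_eq_zero.1 e1 with e | e
    · apply hj
      apply φ.injective
      have e' := sub_eq_zero.1 e
      refine Prod.ext e' ?_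
      rw [e'] at h1
      linear_combination h3 - h1
    · apply hi
      apply φ.injective
      have e' := sub_eq_zero.1 e
      refine Prod.ext e' ?_
      rw [e'] at h1
      linear_combination h1 - h2

open Classical in
theorem dense_case {V : Type} [Fintype V] (G : SimpleGraph V) (s : ℕ) (hs : 0 < s) (hK : KF G s)
    (L : ℝ) (hL : 4 * (s : ℝ) ≤ L) (k : ℕ) (hk : 0 < k) (h : ℕ) (hh : 2 ≤ h)
    (H : Fin h → Fin h → Prop)
    (hH1 : ∀ j, ∃ S : Finset (Fin h), k ≤ S.card ∧ ∀ i ∈ S, H i j)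
    (hH2 : ∀ i i' j j', i ≠ i' → j ≠ j' → H i j → H i' j → H i j' → H i' j' → False)
    (hLh : (h : ℝ) * h + h + h + 1 ≤ L) (M e : ℕ)
    (hdeg : ∀ v, ((nb G v).card : ℝ) ≤ L ^ M) (u : V)
    (hu : L ^ M ≤ L ^ e * ((Finset.univ.filter (fun v =>
      L ^ M ≤ L ^ e * ((nb G u ∩ nb G v).card : ℝ))).card : ℝ))
    (hM : (e + (h + h + 1)) * (h + 1) + h * h + 4 ≤ M) :
    ∃ t : Finset V, (G.induce (t : Set V)).Colorable 2 ∧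
          ¬ HasSubgraphCopy (G.induce (t : Set V)) (cycleGraph 4) ∧
          (k : ℝ) ≤ avgDeg (G.induce (t : Set V)) := by
  obtain ⟨x, y, hxy, hx, hy, hxx, hyy⟩ := dense G s hs hK L hL h h hh H hLh (nb G u) _ M e
    (hdeg u) hu (by
      intro b hb
      rw [Finset.mem_filter] at hb
      have : (nb G u).filter (fun a => G.Adj b a) = nb G u ∩ nb G b := by
        ext a
        rw [Finset.mem_filter, Finset.mem_inter, mem_nb, mem_nb]
      rw [this]
      exact hb.2) hM
  refine finish G k (Finset.univ.image x) (Finset.univ.image y) ?_ ?_ ?_ ?_ ?_ ?_ ?_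
  · intro a ha b hb
    simp only [Finset.mem_image, Finset.mem_univ, true_and] at ha hb
    obtain ⟨i, rfl⟩ := ha
    obtain ⟨j, rfl⟩ := hb
    exact hxx i j
  · intro a ha b hb
    simp only [Finset.mem_image, Finset.mem_univ, true_and] at ha hb
    obtain ⟨i, rfl⟩ := ha
    obtain ⟨j, rfl⟩ := hb
    exact hyy i j
  · rw [Finset.disjoint_left]
    intro a ha hb
    simp only [Finset.mem_image, Finset.mem_univ, true_and] at ha hb
    obtain ⟨i, rfl⟩ := ha
    obtain ⟨j, hj⟩ := hb
    obtain ⟨S, hS, hS'⟩ := hH1 j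
    have : S.Nonempty := by rw [← Finset.card_pos]; omega
    obtain ⟨i', hi'⟩ := this
    have := (hxy i' j).2 (hS' i' hi')
    rw [hj] at this
    exact hxx _ _ this
  · intro b hb
    simp only [Finset.mem_image, Finset.mem_univ, true_and] at hb
    obtain ⟨j, rfl⟩ := hb
    obtain ⟨S, hS, hS'⟩ := hH1 j
    rw [← Finset.card_image_of_injective S hx] at hS
    refine hS.trans (Finset.card_le_card ?_)
    intro a ha
    rw [Finset.mem_image] at ha
    obtain ⟨i, hi, rfl⟩ := ha
    rw [Finset.mem_filter]
    exact ⟨Finset.mem_image_of_mem _ (Finset.mem_univ _), ((hxy i j).2 (hS' i hi)).symm⟩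
  · intro b hb b' hb' a ha a' ha' h1 h2 h3 h4 h5 h6
    simp only [Finset.mem_image, Finset.mem_univ, true_and] at ha hb ha' hb'
    obtain ⟨i, rfl⟩ := ha
    obtain ⟨j, rfl⟩ := hb
    obtain ⟨i', rfl⟩ := ha'
    obtain ⟨j', rfl⟩ := hb'
    exact hH2 i i' j j' (fun h => h2 (by rw [h])) (fun h => h1 (by rw [h]))
      ((hxy _ _).1 h3.symm) ((hxy _ _).1 h4.symm) ((hxy _ _).1 h5.symm) ((hxy _ _).1 h6.symm)
  · rw [Finset.card_image_of_injective _ hx, Finset.card_image_of_injective _ hy]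
  · exact ⟨y ⟨0, by omega⟩, Finset.mem_image_of_mem _ (Finset.mem_univ _)⟩

open Classical in
theorem sum_nb {V : Type} [Fintype V] (G : SimpleGraph V) :
    ∑ v, ((nb G v).card : ℝ) = 2 * (G.edgeSet.ncard : ℝ) := by
  have h := G.sum_degrees_eq_twice_card_edges
  have h1 : ∀ v, (nb G v).card = G.degree v := by
    intro v
    rw [← SimpleGraph.card_neighborFinset_eq_degree]
    congr 1
    ext a
    simp [mem_nb]
  have h2 : G.edgeSet.ncard = G.edgeFinset.card := by
    rw [Set.ncard_eq_toFinset_card', SimpleGraph.edgeFinset]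
  rw [h2]
  simp_rw [h1]
  exact_mod_cast h

theorem ncard_nb {V : Type} [Fintype V] (G : SimpleGraph V) (v : V) :
    (G.neighborSet v).ncard = (nb G v).card := by
  rw [← Set.ncard_coe_finset]
  congr 1
  ext a
  simp [mem_nb]

end IndC4

/-- For every positive integer `k` there are `ε > 0` and a polynomial
`p_k` such that for every `s ≥ 2` and `Δ ≥ p_k(s)`, every `K_{s,s}`-subgraph-free graph
with maximum degree at most `Δ` and average degree at least `Δ^(1-ε)` has a
`C₄`-subgraph-free bipartite induced subgraph of average degree at least `k`. -/
theorem stmt_11 (k : ℕ) (hk : 0 < k) :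
    ∃ ε : ℝ, 0 < ε ∧ ∃ p : Polynomial ℝ, ∀ s : ℕ, 2 ≤ s → ∀ Δ : ℝ, p.eval (s : ℝ) ≤ Δ →
      ∀ (V : Type) [Fintype V], ∀ G : SimpleGraph V,
        ¬ HasSubgraphCopy G (completeBipartiteGraph (Fin s) (Fin s)) →
        (∀ v : V, ((G.neighborSet v).ncard : ℝ) ≤ Δ) →
        Δ ^ ((1 : ℝ) - ε) ≤ avgDeg G →
        ∃ t : Finset V, (G.induce (t : Set V)).Colorable 2 ∧
          ¬ HasSubgraphCopy (G.induce (t : Set V)) (cycleGraph 4) ∧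
          (k : ℝ) ≤ avgDeg (G.induce (t : Set V)) := by
  classical
  obtain ⟨h, H, hh, hH1, hH2⟩ := IndC4.plane k
  obtain ⟨r, hr⟩ : ∃ r, r = 2 + (3 + k) * k := ⟨_, rfl⟩
  obtain ⟨g, hg⟩ : ∃ g, g = 2 * (r + 1) := ⟨_, rfl⟩
  obtain ⟨M, hMd⟩ : ∃ M, M = ((2 * k * g + (h + h + 1)) * (h + 1) + h * h + 4) +
    (2 * k + 5) + (k * g + 1) := ⟨_, rfl⟩
  have hM0 : M ≠ 0 := by omega
  have hMR : (M : ℝ) ≠ 0 := by exact_mod_cast hM0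
  refine ⟨1 / (M : ℝ), by positivity, (Polynomial.C 4 * Polynomial.X +
    Polynomial.C ((h : ℝ) * h + h + h + 1 + 4 * ((k : ℝ) + 1))) ^ M, ?_⟩
  intro s hs Δ hΔ V _ G hG hdeg havg
  have hK := IndC4.KF_of G s hG
  simp only [Polynomial.eval_pow, Polynomial.eval_add, Polynomial.eval_mul, Polynomial.eval_C,
    Polynomial.eval_X] at hΔ
  set b : ℝ := 4 * (s : ℝ) + ((h : ℝ) * h + h + h + 1 + 4 * ((k : ℝ) + 1)) with hb
  have hb0 : 0 < b := by positivity
  have hΔ0 : 0 < Δ := lt_of_lt_of_le (by positivity) hΔ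
  set L : ℝ := Δ ^ (1 / (M : ℝ)) with hLd
  have hL0 : 0 < L := Real.rpow_pos_of_pos hΔ0 _
  have hLM : L ^ M = Δ := by
    rw [hLd, one_div]; exact Real.rpow_inv_natCast_pow hΔ0.le hM0
  have hbL : b ≤ L := by
    rw [← hLM] at hΔ
    exact le_of_pow_le_pow_left₀ hM0 hL0.le hΔ
  have hLe : L * Δ ^ ((1 : ℝ) - 1 / M) = L ^ M := by
    rw [hLM, hLd, ← Real.rpow_add hΔ0]
    simp
  have hh0 : (0 : ℝ) ≤ (h : ℝ) * h + h + h + 1 := by positivity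
  have hs0 : (0 : ℝ) ≤ 4 * (s : ℝ) := by positivity
  have hk0 : (0 : ℝ) ≤ 4 * ((k : ℝ) + 1) := by positivity
  have hdeg' : ∀ v, ((IndC4.nb G v).card : ℝ) ≤ L ^ M := by
    intro v
    rw [hLM, ← IndC4.ncard_nb]
    exact hdeg v
  have hpos : 0 < avgDeg G := lt_of_lt_of_le (Real.rpow_pos_of_pos hΔ0 _) havg
  have hn : 0 < Fintype.card V := by
    by_contra hc
    have : Fintype.card V = 0 := by omega
    rw [avgDeg, this] at hpos
    simp at hpos
  have hnR : (0 : ℝ) < Fintype.card V := by exact_mod_cast hn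
  have havg' : (Fintype.card V : ℝ) * L ^ M ≤ L * ∑ v, ((IndC4.nb G v).card : ℝ) := by
    rw [IndC4.sum_nb, ← hLe]
    rw [avgDeg, le_div_iff₀ hnR] at havg
    have := mul_le_mul_of_nonneg_left havg hL0.le
    linarith
  by_cases hcase : ∃ u, L ^ M ≤ L ^ (2 * k * g) * ((Finset.univ.filter (fun v =>
      L ^ M ≤ L ^ (2 * k * g) * ((IndC4.nb G u ∩ IndC4.nb G v).card : ℝ))).card : ℝ)
  · obtain ⟨u, hu⟩ := hcase
    have := IndC4.dense_case G s (by omega) hK L (by linarith) k hk h hh H hH1 hH2 (by linarith)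
      M (2 * k * g) hdeg' u (by convert hu) (by omega)
    convert this
  · push Not at hcase
    have := IndC4.sparse G s (by omega) hK L (by linarith) k hk (by linarith) r g M hr hg
      (by omega) (by omega) hdeg' hn havg' (by intro u; convert (hcase u).le)
    convert this
end

section
/- For every graph H, there exists a constant k = k(H) such that every graph that contains no cycle of length 4 as a subgraph and contains no induced subdivision of H has average degree less than k. -/
open SimpleGraph

/-! ### Subdivisions up to isomorphism -/

def SubdIso {V W : Type} (H : SimpleGraph V) (S : SimpleGraph W) : Prop :=
  ∃ (U : Type) (T : SimpleGraph U), IsSubdivision H T ∧ Nonempty (T ≃g S)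

lemma edgeSubdiv_adj_some_some {V : Type} (G : SimpleGraph V) (a b x y : V) :
    (edgeSubdiv G a b).Adj (some x) (some y) ↔
      G.Adj x y ∧ ¬((x = a ∧ y = b) ∨ (x = b ∧ y = a)) := by
  unfold edgeSubdiv
  rw [SimpleGraph.fromRel_adj]
  constructor
  · rintro ⟨hne, h⟩
    rcases h with h | h
    · rcases h with ⟨x', y', hx, hy, h1, h2⟩ | ⟨h, _⟩
      · cases hx; cases hy; exact ⟨h1, h2⟩
      · cases h
    · rcases h with ⟨x', y', hx, hy, h1, h2⟩ | ⟨h, _⟩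
      · cases hx; cases hy; exact ⟨h1.symm, by tauto⟩
      · cases h
  · rintro ⟨h1, h2⟩
    exact ⟨by simpa using h1.ne, Or.inl (Or.inl ⟨x, y, rfl, rfl, h1, h2⟩)⟩

lemma edgeSubdiv_adj_none_some {V : Type} (G : SimpleGraph V) (a b y : V) :
    (edgeSubdiv G a b).Adj none (some y) ↔ (y = a ∨ y = b) := by
  unfold edgeSubdiv
  rw [SimpleGraph.fromRel_adj]
  simp

lemma SubdIso.of_isSubdivision {V W : Type} {H : SimpleGraph V} {S : SimpleGraph W}
    (h : IsSubdivision H S) : SubdIso H S := ⟨W, S, h, ⟨SimpleGraph.Iso.refl⟩⟩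

lemma SubdIso.step {V P Q : Type} {H : SimpleGraph V} {X : SimpleGraph P} {Y : SimpleGraph Q}
    (h : SubdIso H X) {a b : P} (hab : X.Adj a b) (f : P → Q) (hf : Function.Injective f)
    (z : Q) (hz : ∀ p, f p ≠ z) (hs : ∀ q, q = z ∨ ∃ p, f p = q)
    (h1 : ∀ u v, Y.Adj (f u) (f v) ↔ X.Adj u v ∧ ¬((u = a ∧ v = b) ∨ (u = b ∧ v = a)))
    (h2 : ∀ u, Y.Adj z (f u) ↔ (u = a ∨ u = b)) : SubdIso H Y := by
  obtain ⟨U, T, hT, ⟨φ⟩⟩ := h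
  have hadj : T.Adj (φ.symm a) (φ.symm b) := by
    rw [φ.symm.map_adj_iff]; exact hab
  refine ⟨_, _, IsSubdivision.step H T _ _ hT hadj, ⟨?_⟩⟩
  let g : Option U → Q := fun o => o.elim z (fun u => f (φ u))
  have hg : Function.Bijective g := by
    constructor
    · rintro (_ | x) (_ | y) hxy
      · rfl
      · exact absurd hxy.symm (hz _)
      · exact absurd hxy (hz _)
      · have := φ.injective (hf hxy)
        rw [this]
    · intro q
      rcases hs q with rfl | ⟨p, rfl⟩
      · exact ⟨none, rfl⟩
      · exact ⟨some (φ.symm p), by simp [g]⟩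
  have key : ∀ (x : U) (p : P), x = φ.symm p ↔ φ x = p := by
    intro x p
    constructor
    · rintro rfl; simp
    · rintro rfl; simp
  refine ⟨Equiv.ofBijective g hg, ?_⟩
  rintro (_ | x) (_ | y)
  · simp
  · simp only [Equiv.ofBijective_apply]
    rw [edgeSubdiv_adj_none_some, key, key]
    exact h2 (φ y)
  · simp only [Equiv.ofBijective_apply]
    rw [SimpleGraph.adj_comm, (edgeSubdiv _ _ _).adj_comm, edgeSubdiv_adj_none_some, key, key]
    exact h2 (φ x)
  · simp only [Equiv.ofBijective_apply]
    rw [edgeSubdiv_adj_some_some, key, key, key, key, ← φ.map_adj_iff]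
    exact h1 (φ x) (φ y)

/-- Adding an edge to the base graph. -/
lemma SubdIso.add_edge {V W : Type} {H : SimpleGraph V} {S : SimpleGraph W}
    (h : IsSubdivision H S) : ∀ x y : V, x ≠ y → ¬ H.Adj x y →
      ∃ x' y' : W, x' ≠ y' ∧ ¬ S.Adj x' y' ∧ SubdIso (H ⊔ edge x y) (S ⊔ edge x' y') := by
  induction h with
  | refl G =>
    intro x y hxy hn
    exact ⟨x, y, hxy, hn, SubdIso.of_isSubdivision (IsSubdivision.refl _)⟩
  | step G T a b hT hab ih =>
    intro x y hxy hn
    obtain ⟨x', y', hxy', hn', hS⟩ := ih x y hxy hn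
    refine ⟨some x', some y', by simpa using hxy', ?_, ?_⟩
    · rw [edgeSubdiv_adj_some_some]; tauto
    · have hab' : (T ⊔ edge x' y').Adj a b := Or.inl hab
      refine hS.step hab' some (Option.some_injective _) none (by simp) ?_ ?_ ?_
      · rintro (_ | q)
        · simp
        · exact Or.inr ⟨q, rfl⟩
      · intro u v
        simp only [SimpleGraph.sup_adj, edgeSubdiv_adj_some_some, edge_adj]
        have := hab.symm
        constructor
        · rintro (h | ⟨h, h'⟩)
          · exact ⟨Or.inl h.1, h.2⟩
          · simp only [Option.some.injEq, ne_eq] at h h'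
            refine ⟨Or.inr ⟨h, h'⟩, ?_⟩
            rintro (⟨rfl, rfl⟩ | ⟨rfl, rfl⟩)
            · rcases h with ⟨rfl, rfl⟩ | ⟨rfl, rfl⟩
              · exact hn' hab
              · exact hn' hab.symm
            · rcases h with ⟨rfl, rfl⟩ | ⟨rfl, rfl⟩
              · exact hn' hab.symm
              · exact hn' hab
        · rintro ⟨h | ⟨h, h'⟩, h2⟩
          · exact Or.inl ⟨h, h2⟩
          · right
            simpa using ⟨h, h'⟩
      · intro u
        simp only [SimpleGraph.sup_adj, edgeSubdiv_adj_none_some, edge_adj]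
        simp

/-- `F` contains a subdivision of `H` as a subgraph. -/
def HasTop {V W : Type} (F : SimpleGraph W) (H : SimpleGraph V) : Prop :=
  ∃ (U : Type) (S : SimpleGraph U), SubdIso H S ∧
    ∃ f : U → W, Function.Injective f ∧ ∀ u v, S.Adj u v → F.Adj (f u) (f v)

lemma HasTop.of_path {V W : Type} {F : SimpleGraph W} {H : SimpleGraph V} {c c' : W}
    (w : F.Walk c c') : w.IsPath → ∀ (P : Type) (T : SimpleGraph P) (f : P → W) (p q : P),
      SubdIso H T → Function.Injective f → T.Adj p q →
      (∀ u v, T.Adj u v → ¬((u = p ∧ v = q) ∨ (u = q ∧ v = p)) → F.Adj (f u) (f v)) →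
      (∀ u, f u ∉ w.support) → F.Adj (f p) c → F.Adj (f q) c' → HasTop F H := by
  induction w with
  | nil =>
    intro hnil P T f p q hT hf hpq hadj hdis h1 h2
    rename_i c
    simp only [Walk.support_nil, List.mem_singleton] at hdis
    refine ⟨Option P, edgeSubdiv T p q, ?_, fun o => o.elim c f, ?_, ?_⟩
    · refine hT.step hpq some (Option.some_injective _) none (by simp) ?_
        (fun u v => edgeSubdiv_adj_some_some _ _ _ _ _) (fun u => edgeSubdiv_adj_none_some _ _ _ _)
      rintro (_ | q)
      · simp
      · exact Or.inr ⟨q, rfl⟩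
    · rintro (_ | x) (_ | y) hxy
      · rfl
      · exact absurd hxy.symm (hdis _)
      · exact absurd hxy (hdis _)
      · rw [hf hxy]
    · have hk : ∀ v, (edgeSubdiv T p q).Adj none (some v) → F.Adj c (f v) := by
        intro v hv
        rw [edgeSubdiv_adj_none_some] at hv
        rcases hv with rfl | rfl
        · exact h1.symm
        · exact h2.symm
      rintro (_ | x) (_ | y) hxy
      · simp at hxy
      · exact hk y hxy
      · exact (hk x hxy.symm).symm
      · rw [edgeSubdiv_adj_some_some] at hxy
        exact hadj x y hxy.1 hxy.2
  | cons hcd w ih =>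
    intro hpath P T f p q hT hf hpq hadj hdis h1 h2
    rename_i c d e
    rw [Walk.cons_isPath_iff] at hpath
    simp only [Walk.support_cons, List.mem_cons, not_or] at hdis
    refine ih hpath.1 (Option P) (edgeSubdiv T p q) (fun o => o.elim c f) none (some q) ?_ ?_ ?_ ?_ ?_
      hcd h2
    · refine hT.step hpq some (Option.some_injective _) none (by simp) ?_
        (fun u v => edgeSubdiv_adj_some_some _ _ _ _ _) (fun u => edgeSubdiv_adj_none_some _ _ _ _)
      rintro (_ | q)
      · simp
      · exact Or.inr ⟨q, rfl⟩
    · rintro (_ | x) (_ | y) hxy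
      · rfl
      · exact absurd hxy.symm (hdis _).1
      · exact absurd hxy (hdis _).1
      · rw [hf hxy]
    · rw [edgeSubdiv_adj_none_some]; simp
    · have hk : ∀ v, (edgeSubdiv T p q).Adj none (some v) → v ≠ q → F.Adj c (f v) := by
        intro v hv hvq
        rw [edgeSubdiv_adj_none_some] at hv
        rcases hv with rfl | rfl
        · exact h1.symm
        · exact absurd rfl hvq
      rintro (_ | x) (_ | y) hxy hne
      · simp at hxy
      · exact hk y hxy (by rintro rfl; simp at hne)
      · exact (hk x hxy.symm (by rintro rfl; simp at hne)).symm
      · rw [edgeSubdiv_adj_some_some] at hxy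
        exact hadj x y hxy.1 hxy.2
    · rintro (_ | x)
      · exact hpath.2
      · exact (hdis x).2

/-! ### Full 1-subdivision -/

/-- Subdivide exactly the edges in `E`. -/
def psd {U : Type} (S : SimpleGraph U) (E : Finset (Sym2 U)) : SimpleGraph (U ⊕ {e // e ∈ E}) where
  Adj x y := match x, y with
    | .inl u, .inl v => S.Adj u v ∧ s(u, v) ∉ E
    | .inl u, .inr e => u ∈ e.1
    | .inr e, .inl u => u ∈ e.1
    | .inr _, .inr _ => False
  symm := ⟨by
    rintro (u | e) (v | e') h
    · exact ⟨h.1.symm, by rw [Sym2.eq_swap]; exact h.2⟩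
    · exact h
    · exact h
    · exact h⟩
  loopless := ⟨by
    rintro (u | e) h
    · exact h.1.ne rfl
    · exact h⟩

lemma psd_subdIso {V U : Type} {H : SimpleGraph V} {S : SimpleGraph U} (h : SubdIso H S)
    (E : Finset (Sym2 U)) : (∀ e ∈ E, e ∈ S.edgeSet) → SubdIso H (psd S E) := by
  classical
  induction E using Finset.induction_on with
  | empty =>
    intro _
    obtain ⟨U', T, hT, ⟨φ⟩⟩ := h
    refine ⟨U', T, hT, ⟨φ.trans ⟨⟨Sum.inl, fun x => x.elim id (fun e => absurd e.2 (Finset.notMem_empty _)), ?_, ?_⟩, ?_⟩⟩⟩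
    · intro u; rfl
    · rintro (u | e)
      · rfl
      · exact absurd e.2 (Finset.notMem_empty _)
    · intro u v
      simp [psd]
  | insert e E he ih =>
    intro hE
    have ih' := ih (fun e' h' => hE e' (Finset.mem_insert_of_mem h'))
    have heS := hE e (Finset.mem_insert_self _ _)
    induction e using Sym2.ind with
    | _ a b =>
    have hab : (psd S E).Adj (Sum.inl a) (Sum.inl b) := ⟨heS, he⟩
    refine ih'.step hab (fun x => x.elim Sum.inl
      (fun e' => Sum.inr ⟨e'.1, Finset.mem_insert_of_mem e'.2⟩)) ?_
      (Sum.inr ⟨s(a, b), Finset.mem_insert_self _ _⟩) ?_ ?_ ?_ ?_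
    · rintro (u | ⟨e, h1⟩) (v | ⟨e', h2⟩) huv <;> simp_all
    · rintro (u | ⟨e', h2⟩)
      · simp
      · simp only [Sum.elim_inr, ne_eq, Sum.inr.injEq, Subtype.mk.injEq]
        rintro rfl
        exact he h2
    · rintro (u | ⟨e', h2⟩)
      · exact Or.inr ⟨Sum.inl u, rfl⟩
      · rcases Finset.mem_insert.1 h2 with rfl | h3
        · exact Or.inl rfl
        · exact Or.inr ⟨Sum.inr ⟨e', h3⟩, rfl⟩
    · rintro (u | ⟨e, h1⟩) (v | ⟨e', h2⟩)
      · simp only [Sum.elim_inl, psd, Finset.mem_insert, not_or, Sum.inl.injEq, Sym2.eq_iff]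
        tauto
      · simp [psd]
      · simp [psd]
      · simp [psd]
    · rintro (u | ⟨e, h1⟩)
      · simp [psd]
      · simp [psd]

/-! ### Mader's theorem -/

open Classical in
/-- degree of `v` into the set `S` -/
noncomputable def dg {V : Type} (F : SimpleGraph V) (S : Finset V) (v : V) : ℕ :=
  ∑ u ∈ S, if F.Adj v u then 1 else 0

/-- twice the number of edges inside `S` -/
noncomputable def e2 {V : Type} (F : SimpleGraph V) (S : Finset V) : ℕ :=
  ∑ v ∈ S, dg F S v

open Classical in
lemma dg_eq_card {V : Type} (F : SimpleGraph V) (S : Finset V) (v : V) :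
    dg F S v = (S.filter (fun u => F.Adj v u)).card := by
  unfold dg
  rw [Finset.card_filter]

open Classical in
lemma e2_insert {V : Type} (F : SimpleGraph V) (S : Finset V) (y : V) (hy : y ∉ S) :
    e2 F (insert y S) = e2 F S + 2 * dg F S y := by
  unfold e2
  rw [Finset.sum_insert hy]
  have h1 : dg F (insert y S) y = dg F S y := by
    unfold dg
    rw [Finset.sum_insert hy]; simp
  have h2 : ∀ v ∈ S, dg F (insert y S) v = (if F.Adj y v then 1 else 0) + dg F S v := by
    intro v _
    unfold dg
    rw [Finset.sum_insert hy]
    simp only [F.adj_comm v y]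
  rw [h1, Finset.sum_congr rfl h2, Finset.sum_add_distrib]
  change _ + (dg F S y + _) = _
  ring

/-- walk-connected set -/
def WConn {V : Type} (F : SimpleGraph V) (C : Finset V) : Prop :=
  ∀ u ∈ C, ∀ v ∈ C, ∃ w : F.Walk u v, ∀ z ∈ w.support, z ∈ C

open Classical in
lemma WConn.insert {V : Type} {F : SimpleGraph V} {C : Finset V} (h : WConn F C) {y c : V}
    (hc : c ∈ C) (hy : F.Adj y c) : WConn F (insert y C) := by
  have key : ∀ v ∈ C, ∃ w : F.Walk y v, ∀ z ∈ w.support, z ∈ (Insert.insert y C : Finset V) := by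
    intro v hv
    obtain ⟨w, hw⟩ := h c hc v hv
    refine ⟨Walk.cons hy w, ?_⟩
    intro z hz
    rw [Walk.support_cons, List.mem_cons] at hz
    rcases hz with rfl | hz
    · simp
    · exact Finset.mem_insert_of_mem (hw z hz)
  intro u hu v hv
  rcases Finset.mem_insert.1 hu with rfl | hu'
  · rcases Finset.mem_insert.1 hv with rfl | hv'
    · exact ⟨Walk.nil, by simp⟩
    · exact key v hv'
  · rcases Finset.mem_insert.1 hv with rfl | hv'
    · obtain ⟨w, hw⟩ := key u hu'
      exact ⟨w.reverse, by intro z hz; rw [Walk.support_reverse, List.mem_reverse] at hz; exact hw z hz⟩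
    · obtain ⟨w, hw⟩ := h u hu' v hv'
      exact ⟨w, fun z hz => Finset.mem_insert_of_mem (hw z hz)⟩

open Classical in
lemma mader_core {V : Type} [Fintype V] [Nonempty V] (F : SimpleGraph V) (k : ℕ) (hk : 1 ≤ k)
    (hF : 2 * k * Fintype.card V ≤ e2 F Finset.univ) :
    ∃ C N : Finset V, WConn F C ∧ N.Nonempty ∧ (∀ y ∈ N, y ∉ C ∧ ∃ c ∈ C, F.Adj y c) ∧
      ∀ y ∈ N, k ≤ dg F N y := by
  -- minimal dense set
  obtain ⟨X, hX, hXmin⟩ := Finset.exists_min_image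
    ((Finset.univ : Finset (Finset V)).filter
      (fun X => X.Nonempty ∧ 2 * k * X.card ≤ e2 F X)) Finset.card
    ⟨Finset.univ, by simpa using hF⟩
  simp only [Finset.mem_filter, Finset.mem_univ, true_and] at hX hXmin
  obtain ⟨⟨v, hv⟩, hXd⟩ := hX
  let Nb : Finset V → Finset V := fun C => (X \ C).filter (fun u => ∃ c ∈ C, F.Adj u c)
  obtain ⟨C, hC, hCmax⟩ := Finset.exists_max_image
    ((Finset.univ : Finset (Finset V)).filter
      (fun C => C.Nonempty ∧ C ⊆ X ∧ WConn F C ∧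
        2 * k * ((X \ C).card + 1) ≤ e2 F (X \ C) + 2 * (Nb C).card)) Finset.card
    ⟨{v}, by
      simp only [Finset.mem_filter, Finset.mem_univ, true_and]
      refine ⟨⟨v, by simp⟩, by simpa using hv, ?_, ?_⟩
      · intro a ha b hb
        simp only [Finset.mem_singleton] at ha hb
        subst ha; subst hb
        exact ⟨Walk.nil, by simp⟩
      · have h1 : X = insert v (X \ {v}) := by
          ext x; by_cases hxv : x = v <;> simp [hxv, hv]
        have h2 : v ∉ X \ {v} := by simp
        have h3 := e2_insert F _ v h2
        have h4 : X.card = (X \ {v}).card + 1 := by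
          conv_lhs => rw [h1]
          rw [Finset.card_insert_of_notMem h2]
        rw [← h1, dg_eq_card] at h3
        have h5 : Nb {v} = (X \ {v}).filter (fun u => F.Adj v u) := by
          ext x; simp [Nb, F.adj_comm x v]
        rw [h5, ← h3, ← h4]
        exact hXd⟩
  simp only [Finset.mem_filter, Finset.mem_univ, true_and] at hC hCmax
  obtain ⟨hCne, hCX, hCconn, hCd⟩ := hC
  refine ⟨C, Nb C, hCconn, ?_, ?_, ?_⟩
  · by_contra hne
    rw [Finset.not_nonempty_iff_eq_empty] at hne
    rw [hne] at hCd
    simp only [Finset.card_empty, mul_zero, add_zero] at hCd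
    by_cases hR : (X \ C).Nonempty
    · have := hXmin (X \ C) ⟨hR, by nlinarith⟩
      have h2 : (X \ C).card < X.card := by
        apply Finset.card_lt_card
        refine ⟨Finset.sdiff_subset, ?_⟩
        intro h
        obtain ⟨c, hc⟩ := hCne
        have := h (hCX hc)
        simp [hc] at this
      omega
    · rw [Finset.not_nonempty_iff_eq_empty] at hR
      rw [hR] at hCd
      simp [e2] at hCd
      omega
  · intro y hy
    simp only [Nb, Finset.mem_filter, Finset.mem_sdiff] at hy
    exact ⟨hy.1.2, hy.2⟩
  · intro y hy
    have hy' := hy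
    simp only [Nb, Finset.mem_filter, Finset.mem_sdiff] at hy'
    obtain ⟨⟨hyX, hyC⟩, c, hc, hyc⟩ := hy'
    set R' := X \ insert y C with hR'
    have hR : X \ C = insert y R' := by
      ext x; by_cases hxy : x = y <;> simp [hR', hxy, hyX, hyC]
    have hyR' : y ∉ R' := by simp [hR']
    have hcardR : (X \ C).card = R'.card + 1 := by
      rw [hR, Finset.card_insert_of_notMem hyR']
    have he : e2 F (X \ C) = e2 F R' + 2 * dg F R' y := by
      rw [hR, e2_insert F _ _ hyR']
    have hlt : e2 F R' + 2 * (Nb (insert y C)).card < 2 * k * (R'.card + 1) := by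
      by_contra hcon
      push Not at hcon
      have := hCmax (insert y C) ⟨⟨y, by simp⟩, by
        intro x hx
        rcases Finset.mem_insert.1 hx with rfl | hx
        · exact hyX
        · exact hCX hx, hCconn.insert hc hyc, hcon⟩
      rw [Finset.card_insert_of_notMem hyC] at this
      omega
    have hN : (Nb C).card + dg F R' y ≤ (Nb (insert y C)).card + 1 + dg F (Nb C) y := by
      rw [dg_eq_card, dg_eq_card]
      have h1 := Finset.card_union_add_card_inter ((Nb C).erase y) (R'.filter (fun u => F.Adj y u))
      have h2 : ((Nb C).erase y ∪ R'.filter (fun u => F.Adj y u)).card ≤ (Nb (insert y C)).card := by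
        apply Finset.card_le_card
        intro x hx
        simp only [Nb, hR', Finset.mem_union, Finset.mem_erase, Finset.mem_filter, Finset.mem_sdiff,
          Finset.mem_insert, not_or] at hx ⊢
        rcases hx with ⟨hxy, ⟨hx1, hx2⟩, d, hd, hxd⟩ | ⟨hx, hx'⟩
        · exact ⟨⟨hx1, hxy, hx2⟩, d, Or.inr hd, hxd⟩
        · exact ⟨hx, y, Or.inl rfl, hx'.symm⟩
      have h3 : ((Nb C).erase y ∩ R'.filter (fun u => F.Adj y u)).card ≤
          ((Nb C).filter (fun u => F.Adj y u)).card := by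
        apply Finset.card_le_card
        intro x hx
        simp only [Finset.mem_inter, Finset.mem_erase, Finset.mem_filter] at hx ⊢
        tauto
      have h4 := Finset.card_erase_add_one hy
      omega
    rw [hcardR] at hCd
    have : 2 * k * (R'.card + 1 + 1) = 2 * k * (R'.card + 1) + 2 * k := by ring
    omega

theorem mader {VH : Type} [Fintype VH] (H : SimpleGraph VH) :
    ∃ k : ℕ, ∀ (V : Type) [Fintype V] [Nonempty V] (F : SimpleGraph V),
      k * Fintype.card V ≤ e2 F Finset.univ → HasTop F H := by
  classical
  induction H using WellFoundedLT.induction with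
  | _ H ih =>
  by_cases hH : H = ⊥
  · refine ⟨Fintype.card VH, ?_⟩
    intro V _ _ F hF
    have hex : ∃ v, Fintype.card VH ≤ dg F Finset.univ v := by
      by_contra hcon
      push Not at hcon
      have : e2 F Finset.univ < ∑ v : V, Fintype.card VH :=
        Finset.sum_lt_sum_of_nonempty Finset.univ_nonempty (fun v _ => hcon v)
      rw [Finset.sum_const, Finset.card_univ, smul_eq_mul] at this
      nlinarith
    obtain ⟨v, hv⟩ := hex
    have hcard : Fintype.card VH ≤ Fintype.card V := by
      rw [dg_eq_card] at hv
      exact hv.trans (Finset.card_le_univ _)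
    obtain ⟨f⟩ := Function.Embedding.nonempty_of_card_le hcard
    refine ⟨VH, H, SubdIso.of_isSubdivision (IsSubdivision.refl _), f, f.injective, ?_⟩
    subst hH
    intro u v h
    exact absurd h (by simp)
  · have hex : ∃ x y, H.Adj x y := by
      by_contra hcon
      push Not at hcon
      apply hH
      ext x y
      simp [hcon x y]
    obtain ⟨x, y, hxy⟩ := hex
    set H' := H.deleteEdges {s(x, y)} with hH'
    have hn : ¬ H'.Adj x y := by simp [hH']
    have hlt : H' < H := by
      refine lt_of_le_of_ne (deleteEdges_le _) ?_
      intro h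
      rw [h] at hn
      exact hn hxy
    have hsup : H' ⊔ edge x y = H := by
      ext a b
      simp only [hH', SimpleGraph.sup_adj, deleteEdges_adj, edge_adj, Set.mem_singleton_iff,
        Sym2.eq_iff]
      constructor
      · rintro (h | ⟨⟨rfl, rfl⟩ | ⟨rfl, rfl⟩, _⟩)
        · exact h.1
        · exact hxy
        · exact hxy.symm
      · intro h
        have := h.ne
        tauto
    obtain ⟨k, hk⟩ := ih H' hlt
    refine ⟨2 * (k + 1), ?_⟩
    intro V _ _ F hF
    obtain ⟨C, N, hC, hNne, hNC, hNd⟩ := mader_core F (k + 1) (by omega) hF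
    have : Nonempty {v // v ∈ N} := ⟨⟨hNne.choose, hNne.choose_spec⟩⟩
    have htop := hk {v // v ∈ N} (F.comap Subtype.val) (by
      unfold e2
      have : ∀ v : {v // v ∈ N}, k ≤ dg (F.comap Subtype.val) Finset.univ v := by
        intro v
        have h1 : dg (F.comap (Subtype.val : {v // v ∈ N} → V)) Finset.univ v = dg F N v.1 := by
          unfold dg
          rw [← Finset.sum_coe_sort N]
          rfl
        rw [h1]
        have := hNd v.1 v.2
        omega
      calc k * Fintype.card {v // v ∈ N} = ∑ v : {v // v ∈ N}, k := by
            rw [Finset.sum_const, Finset.card_univ, smul_eq_mul, mul_comm]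
        _ ≤ _ := Finset.sum_le_sum (fun v _ => this v))
    obtain ⟨U, S, ⟨U', T, hT, ⟨φ⟩⟩, f, hf, hfa⟩ := htop
    obtain ⟨x', y', hxy', hn', hS⟩ := SubdIso.add_edge hT x y hxy.ne hn
    rw [hsup] at hS
    let g : U' → V := fun u => (f (φ u)).1
    have hg : Function.Injective g := fun a b hab => φ.injective (hf (Subtype.ext hab))
    obtain ⟨_, c, hc, hxc⟩ := hNC (g x') (f (φ x')).2
    obtain ⟨_, c', hc', hyc⟩ := hNC (g y') (f (φ y')).2
    obtain ⟨w, hw⟩ := hC c hc c' hc'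
    refine HasTop.of_path w.bypass w.bypass_isPath U' (T ⊔ edge x' y') g x' y' hS hg ?_ ?_ ?_ hxc hyc
    · right
      rw [edge_adj]
      exact ⟨Or.inl ⟨rfl, rfl⟩, hxy'⟩
    · intro u v huv hne
      rcases huv with huv | huv
      · exact hfa _ _ (φ.map_adj_iff.2 huv)
      · rw [edge_adj] at huv
        tauto
    · intro u hu
      exact (hNC (g u) (f (φ u)).2).1 (hw _ (w.support_bypass_subset_support hu))

/-! ### Large independent sets -/

/-- no two distinct vertices have two common neighbours -/
def NoC4 {V : Type} (G : SimpleGraph V) : Prop :=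
  ∀ a b x y : V, a ≠ b → G.Adj a x → G.Adj b x → G.Adj a y → G.Adj b y → x = y

def Indep {V : Type} (G : SimpleGraph V) (W : Finset V) : Prop :=
  ∀ x ∈ W, ∀ y ∈ W, ¬ G.Adj x y

open Classical in
lemma aks_fibre {V : Type} (G : SimpleGraph V) (hG : NoC4 G) (K D : ℕ)
    (hD : 2 * K * 2 ^ (16 * K) ≤ D) (A : Finset V) (v : V) (hv : v ∈ A) (S : Finset V)
    (hSA : S ⊆ A) (hSI : Indep G S) (hSv : ∀ x ∈ S, x ≠ v ∧ ¬ G.Adj v x) (Φ : Finset (Finset V))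
    (hΦ : ∀ W, W ∈ Φ ↔ W ⊆ A ∧ Indep G W ∧ W.filter (fun x => x ≠ v ∧ ¬ G.Adj v x) = S) :
    2 * K * Φ.card ≤ ∑ W ∈ Φ, (D * (if v ∈ W then 1 else 0) +
      (W.filter (fun x => G.Adj v x)).card) := by
  set X := A.filter (fun u => G.Adj v u ∧ ∀ s ∈ S, ¬ G.Adj u s) with hX
  have hSW : ∀ W ∈ Φ, ∀ x, x ∈ S ↔ x ∈ W ∧ x ≠ v ∧ ¬ G.Adj v x := by
    intro W hW x
    rw [← ((hΦ W).1 hW).2.2]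
    simp
  rcases Nat.lt_or_ge X.card (16 * K) with hlt | hge
  · -- few available neighbours
    have h1 : Φ.card ≤ 2 ^ (16 * K) := by
      have : Φ.card ≤ (insert v X).powerset.card := by
        refine Finset.card_le_card_of_injOn (fun W => W ∩ insert v X) ?_ ?_
        · intro W _
          simp
        · have key : ∀ W ∈ Φ, ∀ W' ∈ Φ, W ∩ insert v X = W' ∩ insert v X → W ⊆ W' := by
            intro W hW W' hW' hEq x hx
            by_cases hxS : x ∈ S
            · exact ((hSW W' hW' x).1 hxS).1
            · have : x ∈ W ∩ insert v X := by
                rw [Finset.mem_inter]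
                refine ⟨hx, ?_⟩
                rw [Finset.mem_insert]
                by_cases hxv : x = v
                · exact Or.inl hxv
                · right
                  have hadj : G.Adj v x := by
                    by_contra hn
                    exact hxS ((hSW W hW x).2 ⟨hx, hxv, hn⟩)
                  rw [hX, Finset.mem_filter]
                  refine ⟨((hΦ W).1 hW).1 hx, hadj, ?_⟩
                  intro s hs
                  exact ((hΦ W).1 hW).2.1 x hx s ((hSW W hW s).1 hs).1
              rw [hEq] at this
              exact (Finset.mem_inter.1 this).1
          intro W hW W' hW' hEq
          exact Finset.Subset.antisymm (key W hW W' hW' hEq) (key W' hW' W hW hEq.symm)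
      refine this.trans ?_
      rw [Finset.card_powerset]
      apply Nat.pow_le_pow_right (by norm_num)
      exact (Finset.card_insert_le _ _).trans hlt
    have hmem : insert v S ∈ Φ := by
      rw [hΦ]
      refine ⟨?_, ?_, ?_⟩
      · intro x hx
        rcases Finset.mem_insert.1 hx with rfl | hx
        · exact hv
        · exact hSA hx
      · intro x hx y hy
        rcases Finset.mem_insert.1 hx with hxv | hxS
        · rw [hxv]
          rcases Finset.mem_insert.1 hy with hyv | hyS
          · rw [hyv]; exact G.loopless.irrefl _
          · exact (hSv y hyS).2
        · rcases Finset.mem_insert.1 hy with hyv | hyS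
          · rw [hyv]; exact fun h => (hSv x hxS).2 h.symm
          · exact hSI x hxS y hyS
      · ext x
        simp only [Finset.mem_filter, Finset.mem_insert]
        constructor
        · rintro ⟨h | h, h1, h2⟩
          · exact absurd h h1
          · exact h
        · intro h
          exact ⟨Or.inr h, hSv x h⟩
    calc 2 * K * Φ.card ≤ 2 * K * 2 ^ (16 * K) := Nat.mul_le_mul_left _ h1
      _ ≤ D := hD
      _ ≤ D * (if v ∈ insert v S then 1 else 0) +
          ((insert v S).filter (fun x => G.Adj v x)).card := by simp
      _ ≤ _ := Finset.single_le_sum (f := fun W => D * (if v ∈ W then 1 else 0) +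
          (W.filter (fun x => G.Adj v x)).card) (fun _ _ => Nat.zero_le _) hmem
  · -- many available neighbours
    have h1 : ∀ u ∈ X, Φ.card ≤ 8 * (Φ.filter (fun W => u ∈ W)).card := by
      intro u hu
      rw [hX, Finset.mem_filter] at hu
      obtain ⟨huA, huv, huS⟩ := hu
      let τ : Finset V → Finset V := fun W =>
        insert u (W.filter (fun x => x ≠ v ∧ ¬ (G.Adj v x ∧ G.Adj u x)))
      refine Finset.card_le_mul_card_image_of_maps_to (f := τ) ?_ 8 ?_
      · intro W hW
        have hW' := (hΦ W).1 hW
        have hu' : ∀ y ∈ W.filter (fun x => x ≠ v ∧ ¬ (G.Adj v x ∧ G.Adj u x)), ¬ G.Adj u y := by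
          intro y hy hadj
          simp only [Finset.mem_filter] at hy
          by_cases hvy : G.Adj v y
          · exact hy.2.2 ⟨hvy, hadj⟩
          · exact huS y ((hSW W hW y).2 ⟨hy.1, hy.2.1, hvy⟩) hadj
        simp only [Finset.mem_filter]
        refine ⟨?_, by simp [τ]⟩
        rw [hΦ]
        refine ⟨?_, ?_, ?_⟩
        · intro x hx
          rcases Finset.mem_insert.1 hx with rfl | hx
          · exact huA
          · exact hW'.1 (Finset.mem_filter.1 hx).1
        · intro x hx y hy
          rcases Finset.mem_insert.1 hx with rfl | hx
          · rcases Finset.mem_insert.1 hy with rfl | hy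
            · exact G.loopless.irrefl _
            · exact hu' y hy
          · rcases Finset.mem_insert.1 hy with rfl | hy
            · exact fun h => hu' x hx h.symm
            · exact hW'.2.1 x (Finset.mem_filter.1 hx).1 y (Finset.mem_filter.1 hy).1
        · rw [← hW'.2.2]
          ext x
          simp only [τ, Finset.mem_filter, Finset.mem_insert]
          constructor
          · rintro ⟨rfl | h, h2, h3⟩
            · exact absurd huv h3
            · exact ⟨h.1, h2, h3⟩
          · rintro ⟨h, h2, h3⟩
            exact ⟨Or.inr ⟨h, h2, fun h' => h3 h'.1⟩, h2, h3⟩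
      · intro W' _
        have : (Finset.univ : Finset (Bool × Bool × Bool)).card = 8 := by simp
        rw [← this]
        refine Finset.card_le_card_of_injOn
          (fun W => (decide (v ∈ W), decide (u ∈ W), decide (∃ m ∈ W, G.Adj v m ∧ G.Adj u m)))
          (fun _ _ => by simp) ?_
        have key : ∀ W1 W2 : Finset V, τ W1 = τ W2 → (v ∈ W1 ↔ v ∈ W2) → (u ∈ W1 ↔ u ∈ W2) →
            ((∃ m ∈ W1, G.Adj v m ∧ G.Adj u m) ↔ (∃ m ∈ W2, G.Adj v m ∧ G.Adj u m)) → W1 ⊆ W2 := by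
          intro W1 W2 hτ hb1 hb2 hb3 x hx
          by_cases hxv : x = v
          · subst hxv; exact hb1.1 hx
          by_cases hxu : x = u
          · subst hxu; exact hb2.1 hx
          by_cases hxm : G.Adj v x ∧ G.Adj u x
          · obtain ⟨m, hm, hm1, hm2⟩ := hb3.1 ⟨x, hx, hxm⟩
            have := hG v u x m huv.ne hxm.1 hxm.2 hm1 hm2
            rw [this]; exact hm
          · have : x ∈ τ W1 := by
              simp only [τ, Finset.mem_insert, Finset.mem_filter]
              exact Or.inr ⟨hx, hxv, hxm⟩
            rw [hτ] at this
            simp only [τ, Finset.mem_insert, Finset.mem_filter] at this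
            rcases this with h | h
            · exact absurd h hxu
            · exact h.1
        intro W1 hW1 W2 hW2 hEq
        simp only [Finset.coe_filter, Set.mem_ofPred_eq] at hW1 hW2
        simp only [Prod.mk.injEq, decide_eq_decide] at hEq
        have hτ : τ W1 = τ W2 := hW1.2.trans hW2.2.symm
        exact Finset.Subset.antisymm (key W1 W2 hτ hEq.1 hEq.2.1 hEq.2.2)
          (key W2 W1 hτ.symm hEq.1.symm hEq.2.1.symm hEq.2.2.symm)
    have h2 : ∑ u ∈ X, (Φ.filter (fun W => u ∈ W)).card ≤
        ∑ W ∈ Φ, (W.filter (fun x => G.Adj v x)).card := by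
      have : ∑ u ∈ X, (Φ.filter (fun W => u ∈ W)).card = ∑ W ∈ Φ, (X.filter (fun u => u ∈ W)).card := by
        simp only [Finset.card_filter]
        exact Finset.sum_comm
      rw [this]
      apply Finset.sum_le_sum
      intro W _
      apply Finset.card_le_card
      intro x hx
      simp only [hX, Finset.mem_filter] at hx ⊢
      exact ⟨hx.2, hx.1.2.1⟩
    have h3 : X.card * Φ.card ≤ 8 * ∑ u ∈ X, (Φ.filter (fun W => u ∈ W)).card := by
      rw [Finset.mul_sum]
      calc X.card * Φ.card = ∑ u ∈ X, Φ.card := by simp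
        _ ≤ _ := Finset.sum_le_sum h1
    have h4 : ∑ W ∈ Φ, (W.filter (fun x => G.Adj v x)).card ≤ ∑ W ∈ Φ, (D * (if v ∈ W then 1 else 0) +
      (W.filter (fun x => G.Adj v x)).card) :=
      Finset.sum_le_sum (fun W _ => Nat.le_add_left _ _)
    have h5 : 16 * K * Φ.card ≤ X.card * Φ.card := Nat.mul_le_mul_right _ hge
    have h6 : 16 * K * Φ.card = 8 * (2 * K * Φ.card) := by ring
    omega

open Classical in
lemma aks {V : Type} (G : SimpleGraph V) (hG : NoC4 G) (K D : ℕ)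
    (hD : 2 * K * 2 ^ (16 * K) ≤ D) (A : Finset V)
    (hA : ∀ v ∈ A, (A.filter (fun x => G.Adj v x)).card ≤ D) :
    ∃ W ⊆ A, Indep G W ∧ K * A.card ≤ D * W.card := by
  set I := A.powerset.filter (fun W => Indep G W) with hI
  by_contra hcon
  push Not at hcon
  have hv : ∀ v ∈ A, 2 * K * I.card ≤ ∑ W ∈ I, (D * (if v ∈ W then 1 else 0) +
      (W.filter (fun x => G.Adj v x)).card) := by
    intro v hv
    let g : Finset V → Finset V := fun W => W.filter (fun x => x ≠ v ∧ ¬ G.Adj v x)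
    have hmaps : ∀ W ∈ I, g W ∈ I.image g := fun W hW => Finset.mem_image_of_mem g hW
    rw [← Finset.sum_fiberwise_of_maps_to hmaps, Finset.card_eq_sum_card_fiberwise hmaps,
      Finset.mul_sum]
    apply Finset.sum_le_sum
    intro S hS
    obtain ⟨W0, hW0, rfl⟩ := Finset.mem_image.1 hS
    rw [hI, Finset.mem_filter, Finset.mem_powerset] at hW0
    refine aks_fibre G hG K D hD A v hv (g W0) ?_ ?_ ?_ _ ?_
    · exact (Finset.filter_subset _ _).trans hW0.1
    · intro x hx y hy
      exact hW0.2 x (Finset.mem_filter.1 hx).1 y (Finset.mem_filter.1 hy).1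
    · intro x hx
      exact (Finset.mem_filter.1 hx).2
    · intro W
      simp only [hI, Finset.mem_filter, Finset.mem_powerset, and_assoc, g]
  have h1 : A.card * (2 * K * I.card) ≤ ∑ W ∈ I, 2 * (D * W.card) := by
    calc A.card * (2 * K * I.card) = ∑ v ∈ A, 2 * K * I.card := by simp
      _ ≤ ∑ v ∈ A, ∑ W ∈ I, (D * (if v ∈ W then 1 else 0) +
          (W.filter (fun x => G.Adj v x)).card) := Finset.sum_le_sum hv
      _ = ∑ W ∈ I, ∑ v ∈ A, (D * (if v ∈ W then 1 else 0) +
          (W.filter (fun x => G.Adj v x)).card) := Finset.sum_comm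
      _ ≤ _ := by
        apply Finset.sum_le_sum
        intro W hW
        rw [hI, Finset.mem_filter, Finset.mem_powerset] at hW
        rw [Finset.sum_add_distrib, ← Finset.mul_sum]
        have e1 : ∑ v ∈ A, (if v ∈ W then 1 else 0) = W.card := by
          rw [← Finset.card_filter, Finset.filter_mem_eq_inter, Finset.inter_eq_right.2 hW.1]
        have e2 : ∑ v ∈ A, (W.filter (fun x => G.Adj v x)).card ≤ D * W.card := by
          simp only [Finset.card_filter]
          rw [Finset.sum_comm]
          calc ∑ y ∈ W, ∑ x ∈ A, (if G.Adj x y then 1 else 0) ≤ ∑ y ∈ W, D := by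
                apply Finset.sum_le_sum
                intro y hy
                have := hA y (hW.1 hy)
                rw [Finset.card_filter] at this
                simpa only [G.adj_comm] using this
            _ = D * W.card := by simp [mul_comm]
        rw [e1]
        omega
  have h2 : ∑ W ∈ I, 2 * (D * W.card) < ∑ W ∈ I, 2 * (K * A.card) := by
    apply Finset.sum_lt_sum_of_nonempty
    · refine ⟨∅, ?_⟩
      rw [hI, Finset.mem_filter]
      exact ⟨by simp, by intro x hx; simp at hx⟩
    · intro W hW
      rw [hI, Finset.mem_filter, Finset.mem_powerset] at hW
      have := hcon W hW.1 hW.2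
      omega
  rw [Finset.sum_const, smul_eq_mul] at h2
  have : A.card * (2 * K * I.card) = I.card * (2 * (K * A.card)) := by ring
  omega

/-! ### Orientation and sampling -/

open Classical in
lemma exists_orientation {V : Type} (G : SimpleGraph V) (d : ℕ)
    (h : ∀ S : Finset V, S.Nonempty → ∃ v ∈ S, dg G S v ≤ d) (S : Finset V) :
    ∃ out : V → Finset V, (∀ v, (out v).card ≤ d) ∧ (∀ u, ∀ v ∈ out u, G.Adj u v) ∧
      ∀ u ∈ S, ∀ v ∈ S, G.Adj u v → v ∈ out u ∨ u ∈ out v := by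
  induction S using Finset.strongInduction with
  | _ S ih =>
  by_cases hS : S.Nonempty
  · obtain ⟨v, hv, hvd⟩ := h S hS
    obtain ⟨out, h1, h2, h3⟩ := ih (S.erase v) (Finset.erase_ssubset hv)
    rw [dg_eq_card] at hvd
    refine ⟨fun u => if u = v then S.filter (fun x => G.Adj v x) else out u, ?_, ?_, ?_⟩
    · intro u
      by_cases hu : u = v
      · simpa [hu] using hvd
      · simpa [hu] using h1 u
    · intro u w hw
      by_cases hu : u = v
      · subst hu
        simp at hw
        exact hw.2
      · simp only [hu, if_false] at hw
        exact h2 u w hw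
    · intro u hu w hw huw
      by_cases huv : u = v
      · subst huv
        left
        simp [hw, huw]
      · by_cases hwv : w = v
        · subst hwv
          right
          simp [hu, huw.symm]
        · simp only [huv, hwv, if_false]
          exact h3 u (Finset.mem_erase.2 ⟨huv, hu⟩) w (Finset.mem_erase.2 ⟨hwv, hw⟩) huw
  · rw [Finset.not_nonempty_iff_eq_empty] at hS
    subst hS
    exact ⟨fun _ => ∅, by simp, by simp, by simp⟩

open Classical in
lemma e2_le_of_orientation {V : Type} [Fintype V] (G : SimpleGraph V) (d : ℕ)
    (out : V → Finset V) (h1 : ∀ v, (out v).card ≤ d)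
    (h3 : ∀ u v, G.Adj u v → v ∈ out u ∨ u ∈ out v) :
    e2 G Finset.univ ≤ 2 * d * Fintype.card V := by
  have hs : ∑ v : V, ∑ u : V, (if u ∈ out v then 1 else 0) ≤ d * Fintype.card V := by
    calc ∑ v : V, ∑ u : V, (if u ∈ out v then 1 else 0) ≤ ∑ v : V, d := by
          apply Finset.sum_le_sum
          intro v _
          rw [← Finset.card_filter]
          simpa using h1 v
      _ = _ := by simp [mul_comm]
  calc e2 G Finset.univ ≤ ∑ v : V, ∑ u : V, ((if u ∈ out v then 1 else 0) +
        (if v ∈ out u then 1 else 0)) := by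
        unfold e2 dg
        apply Finset.sum_le_sum
        intro v _
        apply Finset.sum_le_sum
        intro u _
        by_cases h : G.Adj v u
        · rcases h3 v u h with h' | h' <;> simp [h, h']
        · simp [h]
    _ = ∑ v : V, ∑ u : V, (if u ∈ out v then 1 else 0) +
        ∑ v : V, ∑ u : V, (if v ∈ out u then 1 else 0) := by
        simp only [Finset.sum_add_distrib]
    _ = ∑ v : V, ∑ u : V, (if u ∈ out v then 1 else 0) +
        ∑ v : V, ∑ u : V, (if u ∈ out v then 1 else 0) := by
        congr 1
        exact Finset.sum_comm
    _ ≤ _ := by nlinarith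

open Classical in
lemma half_small {V : Type} [Fintype V] (G : SimpleGraph V) (d : ℕ) (hd : 1 ≤ d)
    (h : e2 G Finset.univ ≤ 2 * d * Fintype.card V) :
    Fintype.card V ≤ 2 * (Finset.univ.filter (fun v => dg G Finset.univ v ≤ 4 * d)).card := by
  set A := Finset.univ.filter (fun v => dg G Finset.univ v ≤ 4 * d) with hA
  have h1 : A.card + (Finset.univ.filter (fun v => ¬ dg G Finset.univ v ≤ 4 * d)).card =
      Fintype.card V := by
    rw [hA, Finset.card_filter_add_card_filter_not, Finset.card_univ]
  set B := Finset.univ.filter (fun v => ¬ dg G Finset.univ v ≤ 4 * d) with hB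
  have h2 : B.card * (4 * d) ≤ e2 G Finset.univ := by
    calc B.card * (4 * d) = ∑ v ∈ B, 4 * d := by simp
      _ ≤ ∑ v ∈ B, dg G Finset.univ v := by
        apply Finset.sum_le_sum
        intro v hv
        rw [hB, Finset.mem_filter] at hv
        omega
      _ ≤ _ := Finset.sum_le_sum_of_subset (Finset.subset_univ _)
  have h3 : d * (2 * B.card) ≤ d * Fintype.card V := by nlinarith
  have h4 := Nat.le_of_mul_le_mul_left h3 hd
  omega

open Classical in
lemma count_zero {V : Type} [Fintype V] (q : ℕ) [NeZero q] (T : Finset V) :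
    (Finset.univ.filter (fun c : V → Fin q => ∀ x ∈ T, c x = 0)).card * q ^ T.card =
      q ^ Fintype.card V := by
  have h1 : Finset.univ.filter (fun c : V → Fin q => ∀ x ∈ T, c x = 0) =
      Fintype.piFinset (fun x => if x ∈ T then {0} else Finset.univ) := by
    ext c
    simp only [Finset.mem_filter, Finset.mem_univ, true_and, Fintype.mem_piFinset]
    constructor
    · intro h x
      by_cases hx : x ∈ T
      · simp [hx, h x hx]
      · simp [hx]
    · intro h x hx
      simpa [hx] using h x
  rw [h1, Fintype.card_piFinset]
  have h2 : ∀ x : V, (if x ∈ T then ({0} : Finset (Fin q)) else Finset.univ).card =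
      if x ∈ T then 1 else q := by
    intro x
    split_ifs <;> simp
  simp only [h2]
  rw [Finset.prod_ite]
  simp only [Finset.prod_const_one, one_mul, Finset.prod_const]
  rw [← pow_add]
  congr 1
  have := Finset.card_filter_add_card_filter_not (s := (Finset.univ : Finset V)) (fun x => x ∈ T)
  simp only [Finset.filter_univ_mem, Finset.card_univ] at this
  omega

open Classical in
/-- number of samples hitting `b₁`, `b₂` and missing `T` -/
lemma count_event {V : Type} [Fintype V] (d : ℕ) (hd : 1 ≤ d) (q : ℕ) [NeZero q] (hq : q = 12 * d)
    (b₁ b₂ : V) (hb : b₁ ≠ b₂) (T : Finset V) (hT : T.card ≤ 6 * d) (h1 : b₁ ∉ T) (h2 : b₂ ∉ T) :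
    q ^ Fintype.card V ≤ 2 * q ^ 2 *
      (Finset.univ.filter (fun c : V → Fin q => c b₁ = 0 ∧ c b₂ = 0 ∧ ∀ x ∈ T, c x ≠ 0)).card := by
  set E := Finset.univ.filter (fun c : V → Fin q => c b₁ = 0 ∧ c b₂ = 0 ∧ ∀ x ∈ T, c x ≠ 0) with hE
  have e0 := count_zero (V := V) q {b₁, b₂}
  rw [Finset.card_pair hb] at e0
  have e1 : ∀ x ∈ T, (Finset.univ.filter (fun c : V → Fin q => ∀ y ∈ ({x, b₁, b₂} : Finset V),
      c y = 0)).card * q ^ 3 = q ^ Fintype.card V := by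
    intro x hx
    have := count_zero (V := V) q {x, b₁, b₂}
    rwa [Finset.card_eq_three.2 ⟨x, b₁, b₂, by rintro rfl; exact h1 hx,
      by rintro rfl; exact h2 hx, hb, rfl⟩] at this
  have hsub : Finset.univ.filter (fun c : V → Fin q => ∀ x ∈ ({b₁, b₂} : Finset V), c x = 0) ⊆
      E ∪ T.biUnion (fun x => Finset.univ.filter
        (fun c : V → Fin q => ∀ y ∈ ({x, b₁, b₂} : Finset V), c y = 0)) := by
    intro c hc
    simp only [Finset.mem_filter, Finset.mem_univ, true_and, Finset.mem_insert,
      Finset.mem_singleton, forall_eq_or_imp, forall_eq] at hc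
    simp only [hE, Finset.mem_union, Finset.mem_biUnion, Finset.mem_filter, Finset.mem_univ,
      true_and, Finset.mem_insert, Finset.mem_singleton, forall_eq_or_imp, forall_eq]
    by_cases hx : ∀ x ∈ T, c x ≠ 0
    · exact Or.inl ⟨hc.1, hc.2, hx⟩
    · push Not at hx
      obtain ⟨x, hx, hx0⟩ := hx
      exact Or.inr ⟨x, hx, hx0, hc.1, hc.2⟩
  have hcard := (Finset.card_le_card hsub).trans (Finset.card_union_le _ _)
  have hbi : (T.biUnion (fun x => Finset.univ.filter
        (fun c : V → Fin q => ∀ y ∈ ({x, b₁, b₂} : Finset V), c y = 0))).card * q ^ 3 ≤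
        6 * d * q ^ Fintype.card V := by
    calc _ ≤ (∑ x ∈ T, (Finset.univ.filter
        (fun c : V → Fin q => ∀ y ∈ ({x, b₁, b₂} : Finset V), c y = 0)).card) * q ^ 3 :=
          Nat.mul_le_mul_right _ Finset.card_biUnion_le
      _ = ∑ x ∈ T, q ^ Fintype.card V := by
          rw [Finset.sum_mul]
          exact Finset.sum_congr rfl e1
      _ = T.card * q ^ Fintype.card V := by simp
      _ ≤ _ := Nat.mul_le_mul_right _ hT
  generalize (T.biUnion (fun x => Finset.univ.filter
        (fun c : V → Fin q => ∀ y ∈ ({x, b₁, b₂} : Finset V), c y = 0))).card = Y at *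
  generalize (Finset.univ.filter
    (fun c : V → Fin q => ∀ x ∈ ({b₁, b₂} : Finset V), c x = 0)).card = Z at *
  generalize q ^ Fintype.card V = M at *
  have h3 : Z * q ^ 2 * q ≤ E.card * q ^ 3 + Y * q ^ 3 := by
    calc Z * q ^ 2 * q = Z * q ^ 3 := by ring
      _ ≤ (E.card + Y) * q ^ 3 := Nat.mul_le_mul_right _ hcard
      _ = _ := by ring
  rw [e0] at h3
  have h4 : M * q ≤ E.card * q ^ 3 + 6 * d * M := h3.trans (Nat.add_le_add_left hbi _)
  have h5 : (6 * d) * M ≤ (6 * d) * (2 * q ^ 2 * E.card) := by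
    have e3 : E.card * q ^ 3 = (6 * d) * (2 * q ^ 2 * E.card) := by
      calc E.card * q ^ 3 = E.card * q ^ 2 * q := by ring
        _ = E.card * q ^ 2 * (12 * d) := congrArg (fun t => E.card * q ^ 2 * t) hq
        _ = _ := by ring
    have e4 : M * q = 12 * d * M := by rw [hq]; ring
    rw [e3, e4] at h4
    have : 12 * d * M = 6 * d * M + 6 * d * M := by ring
    omega
  exact Nat.le_of_mul_le_mul_left h5 (by omega)

open Classical in
lemma pairs_count {V : Type} [Fintype V] (G : SimpleGraph V) (hG : NoC4 G) (d : ℕ) (hd : 4 ≤ d)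
    (a : V) (ha : d ≤ dg G Finset.univ a) :
    d ^ 2 ≤ 2 * (Finset.univ.filter (fun p : V × V => G.Adj a p.1 ∧ G.Adj a p.2 ∧ p.1 ≠ p.2 ∧
      ¬ G.Adj p.1 p.2)).card := by
  rw [dg_eq_card] at ha
  set N := Finset.univ.filter (fun u => G.Adj a u) with hN
  have h1 : Finset.univ.filter (fun p : V × V => G.Adj a p.1 ∧ G.Adj a p.2 ∧ p.1 ≠ p.2 ∧
      ¬ G.Adj p.1 p.2) = (N ×ˢ N).filter (fun p => p.1 ≠ p.2 ∧ ¬ G.Adj p.1 p.2) := by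
    ext p
    simp [hN, and_assoc]
  rw [h1, Finset.card_filter, Finset.sum_product]
  have h2 : ∀ x ∈ N, d - 2 ≤ ∑ y ∈ N, (if x ≠ y ∧ ¬ G.Adj x y then 1 else 0) := by
    intro x hx
    rw [← Finset.card_filter]
    have hx' : G.Adj a x := by simpa [hN] using hx
    have h3 : (N.filter (fun y => G.Adj x y)).card ≤ 1 := by
      rw [Finset.card_le_one]
      intro y hy z hz
      simp only [hN, Finset.mem_filter, Finset.mem_univ, true_and] at hy hz
      exact hG a x y z hx'.ne hy.1 hy.2 hz.1 hz.2
    have h4 : N ⊆ N.filter (fun y => x ≠ y ∧ ¬ G.Adj x y) ∪ (N.filter (fun y => G.Adj x y) ∪ {x}) := by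
      intro y hy
      simp only [Finset.mem_union, Finset.mem_filter, Finset.mem_singleton]
      by_cases h : x = y
      · exact Or.inr (Or.inr h.symm)
      · tauto
    have h5 := (Finset.card_le_card h4).trans (Finset.card_union_le _ _)
    have h6 := Finset.card_union_le (N.filter (fun y => G.Adj x y)) {x}
    simp only [Finset.card_singleton] at h6
    omega
  have h3 : N.card * (d - 2) ≤ ∑ x ∈ N, ∑ y ∈ N, (if x ≠ y ∧ ¬ G.Adj x y then 1 else 0) := by
    calc N.card * (d - 2) = ∑ x ∈ N, (d - 2) := by simp
      _ ≤ _ := Finset.sum_le_sum h2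
  obtain ⟨e, rfl⟩ := Nat.exists_eq_add_of_le hd
  have h4 : (4 + e) * (2 + e) ≤ N.card * (4 + e - 2) := by
    rw [show 4 + e - 2 = 2 + e by omega]
    exact Nat.mul_le_mul_right _ ha
  nlinarith

/-- `a` has exactly two neighbours in `B`. -/
def TwoIn {V : Type} (G : SimpleGraph V) (B : Finset V) (a : V) : Prop :=
  ∃ b₁ ∈ B, ∃ b₂ ∈ B, b₁ ≠ b₂ ∧ G.Adj a b₁ ∧ G.Adj a b₂ ∧ ∀ b ∈ B, G.Adj a b → b = b₁ ∨ b = b₂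

open Classical in
lemma sampling {V : Type} [Fintype V] [Nonempty V] (G : SimpleGraph V) (hG : NoC4 G) (d : ℕ)
    (hd : 4 ≤ d) (hmin : ∀ v, d ≤ dg G Finset.univ v)
    (out : V → Finset V) (hout1 : ∀ v, (out v).card ≤ d) (hout2 : ∀ u, ∀ v ∈ out u, G.Adj u v)
    (hout3 : ∀ u v, G.Adj u v → v ∈ out u ∨ u ∈ out v) :
    ∃ B A : Finset V, Indep G B ∧ (∀ a ∈ A, TwoIn G B a ∧ dg G Finset.univ a ≤ 4 * d) ∧
      12 * d * B.card < 4608 * A.card := by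
  set A₀ := Finset.univ.filter (fun v => dg G Finset.univ v ≤ 4 * d) with hA₀
  have hhalf : Fintype.card V ≤ 2 * A₀.card :=
    half_small G d (by omega) (e2_le_of_orientation G d out hout1 hout3)
  obtain ⟨q, hq⟩ : ∃ q, q = 12 * d := ⟨_, rfl⟩
  have hq0 : NeZero q := ⟨by omega⟩
  let B : (V → Fin q) → Finset V := fun c =>
    Finset.univ.filter (fun v => c v = 0 ∧ ∀ u ∈ out v, c u ≠ 0)
  let A : (V → Fin q) → Finset V := fun c => A₀.filter (fun a => TwoIn G (B c) a)
  have hBind : ∀ c, Indep G (B c) := by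
    intro c x hx y hy hadj
    simp only [B, Finset.mem_filter, Finset.mem_univ, true_and] at hx hy
    rcases hout3 x y hadj with h | h
    · exact hx.2 y h hy.1
    · exact hy.2 x h hx.1
  -- probability that a vertex is good
  have hgood : ∀ a ∈ A₀, q ^ Fintype.card V ≤
      1152 * (Finset.univ.filter (fun c => TwoIn G (B c) a)).card := by
    intro a ha
    rw [hA₀, Finset.mem_filter] at ha
    set P := Finset.univ.filter (fun p : V × V => G.Adj a p.1 ∧ G.Adj a p.2 ∧ p.1 ≠ p.2 ∧
      ¬ G.Adj p.1 p.2) with hP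
    have hPc : d ^ 2 ≤ 2 * P.card := pairs_count G hG d hd a (hmin a)
    let T : V × V → Finset V := fun p =>
      (Finset.univ.filter (fun u => G.Adj a u) ∪ (out p.1 ∪ out p.2)) \ {p.1, p.2}
    let E : V × V → (V → Fin q) → Prop := fun p c =>
      c p.1 = 0 ∧ c p.2 = 0 ∧ ∀ x ∈ T p, c x ≠ 0
    have hE : ∀ p ∈ P, q ^ Fintype.card V ≤ 2 * q ^ 2 * (Finset.univ.filter (E p)).card := by
      intro p hp
      rw [hP, Finset.mem_filter] at hp
      refine count_event d (by omega) q hq p.1 p.2 hp.2.2.2.1 (T p) ?_ (by simp [T]) (by simp [T])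
      have h1 : (T p).card ≤ (Finset.univ.filter (fun u => G.Adj a u) ∪ (out p.1 ∪ out p.2)).card :=
        Finset.card_le_card Finset.sdiff_subset
      have h2 := Finset.card_union_le (Finset.univ.filter (fun u => G.Adj a u)) (out p.1 ∪ out p.2)
      have h3 := Finset.card_union_le (out p.1) (out p.2)
      have h4 := hout1 p.1
      have h5 := hout1 p.2
      have h6 := ha.2
      rw [dg_eq_card] at h6
      omega
    have hEzero : ∀ p ∈ P, ∀ c, E p c → ∀ b, G.Adj a b → c b = 0 → b = p.1 ∨ b = p.2 := by
      intro p hp c hc b hab hb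
      by_contra hcon
      refine hc.2.2 b ?_ hb
      simp only [T, Finset.mem_sdiff, Finset.mem_union, Finset.mem_filter, Finset.mem_univ,
        true_and, Finset.mem_insert, Finset.mem_singleton]
      exact ⟨Or.inl hab, hcon⟩
    have hEgood : ∀ p ∈ P, ∀ c, E p c → TwoIn G (B c) a := by
      intro p hp c hc
      have hz := hEzero p hp c hc
      rw [hP, Finset.mem_filter] at hp
      obtain ⟨-, hp1, hp2, hp3, hp4⟩ := hp
      refine ⟨p.1, ?_, p.2, ?_, hp3, hp1, hp2, ?_⟩
      · simp only [B, Finset.mem_filter, Finset.mem_univ, true_and]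
        refine ⟨hc.1, fun u hu => hc.2.2 u ?_⟩
        have hadj := hout2 _ _ hu
        simp only [T, Finset.mem_sdiff, Finset.mem_union, Finset.mem_insert, Finset.mem_singleton]
        refine ⟨Or.inr (Or.inl hu), ?_⟩
        rintro (h | h)
        · exact hadj.ne h.symm
        · rw [h] at hadj; exact hp4 hadj
      · simp only [B, Finset.mem_filter, Finset.mem_univ, true_and]
        refine ⟨hc.2.1, fun u hu => hc.2.2 u ?_⟩
        have hadj := hout2 _ _ hu
        simp only [T, Finset.mem_sdiff, Finset.mem_union, Finset.mem_insert, Finset.mem_singleton]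
        refine ⟨Or.inr (Or.inr hu), ?_⟩
        rintro (h | h)
        · rw [h] at hadj; exact hp4 hadj.symm
        · exact hadj.ne h.symm
      · intro b hb hab
        simp only [B, Finset.mem_filter, Finset.mem_univ, true_and] at hb
        exact hz b hab hb.1
    have hdouble : ∑ p ∈ P, (Finset.univ.filter (E p)).card ≤
        2 * (Finset.univ.filter (fun c => TwoIn G (B c) a)).card := by
      have e1 : ∑ p ∈ P, (Finset.univ.filter (E p)).card =
          ∑ c : V → Fin q, (P.filter (fun p => E p c)).card := by
        simp only [Finset.card_filter]
        exact Finset.sum_comm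
      rw [e1, Finset.card_filter, Finset.mul_sum]
      apply Finset.sum_le_sum
      intro c _
      by_cases hne : (P.filter (fun p => E p c)).Nonempty
      · obtain ⟨p, hp⟩ := hne
        rw [Finset.mem_filter] at hp
        have hgd := hEgood p hp.1 c hp.2
        simp only [hgd, if_true, mul_one]
        have hsub : P.filter (fun p => E p c) ⊆ {(p.1, p.2), (p.2, p.1)} := by
          intro r hr
          rw [Finset.mem_filter] at hr
          have hr' := hr.1
          rw [hP, Finset.mem_filter] at hr'
          have h1 := hEzero p hp.1 c hp.2 r.1 hr'.2.1 hr.2.1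
          have h2 := hEzero p hp.1 c hp.2 r.2 hr'.2.2.1 hr.2.2.1
          have h3 := hr'.2.2.2.1
          simp only [Finset.mem_insert, Finset.mem_singleton, Prod.ext_iff]
          rcases h1 with h1 | h1 <;> rcases h2 with h2 | h2
          · exact absurd (h1.trans h2.symm) h3
          · exact Or.inl ⟨h1, h2⟩
          · exact Or.inr ⟨h1, h2⟩
          · exact absurd (h1.trans h2.symm) h3
        exact (Finset.card_le_card hsub).trans Finset.card_le_two
      · rw [Finset.not_nonempty_iff_eq_empty] at hne
        rw [hne]
        simp
    generalize (Finset.univ.filter (fun c => TwoIn G (B c) a)).card = Y at *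
    have h1 : P.card * q ^ Fintype.card V ≤ 2 * q ^ 2 * (2 * Y) := by
      calc P.card * q ^ Fintype.card V = ∑ p ∈ P, q ^ Fintype.card V := by simp
        _ ≤ ∑ p ∈ P, 2 * q ^ 2 * (Finset.univ.filter (E p)).card := Finset.sum_le_sum hE
        _ = 2 * q ^ 2 * ∑ p ∈ P, (Finset.univ.filter (E p)).card := by rw [Finset.mul_sum]
        _ ≤ _ := Nat.mul_le_mul_left _ hdouble
    generalize q ^ Fintype.card V = M at *
    have h2 : d ^ 2 * M ≤ d ^ 2 * (1152 * Y) := by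
      calc d ^ 2 * M ≤ 2 * P.card * M := Nat.mul_le_mul_right _ hPc
        _ = 2 * (P.card * M) := by ring
        _ ≤ 2 * (2 * q ^ 2 * (2 * Y)) := Nat.mul_le_mul_left _ h1
        _ = d ^ 2 * (1152 * Y) := by rw [hq]; ring
    exact Nat.le_of_mul_le_mul_left h2 (by positivity)
  have hAsum : Fintype.card V * q ^ Fintype.card V ≤ 2304 * ∑ c, (A c).card := by
    have e1 : ∑ c, (A c).card = ∑ a ∈ A₀, (Finset.univ.filter (fun c => TwoIn G (B c) a)).card := by
      simp only [A, Finset.card_filter]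
      exact Finset.sum_comm
    have e2 : A₀.card * q ^ Fintype.card V ≤ 1152 * ∑ c, (A c).card := by
      rw [e1, Finset.mul_sum]
      calc A₀.card * q ^ Fintype.card V = ∑ a ∈ A₀, q ^ Fintype.card V := by simp
        _ ≤ _ := Finset.sum_le_sum hgood
    have e3 := Nat.mul_le_mul_right (q ^ Fintype.card V) hhalf
    have e4 : 2 * A₀.card * q ^ Fintype.card V = 2 * (A₀.card * q ^ Fintype.card V) := by ring
    omega
  have hBsum : q * ∑ c, (B c).card ≤ Fintype.card V * q ^ Fintype.card V := by
    have e1 : ∑ c, (B c).card ≤ ∑ v : V, (Finset.univ.filter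
        (fun c : V → Fin q => ∀ x ∈ ({v} : Finset V), c x = 0)).card := by
      simp only [Finset.card_filter]
      rw [Finset.sum_comm]
      apply Finset.sum_le_sum
      intro c _
      rw [← Finset.card_filter]
      apply Finset.card_le_card
      intro v hv
      simp only [B, Finset.mem_filter, Finset.mem_univ, true_and] at hv ⊢
      simpa using hv.1
    calc q * ∑ c, (B c).card ≤ q * ∑ v : V, (Finset.univ.filter
        (fun c : V → Fin q => ∀ x ∈ ({v} : Finset V), c x = 0)).card := Nat.mul_le_mul_left _ e1
      _ = ∑ v : V, q ^ Fintype.card V := by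
        rw [Finset.mul_sum]
        apply Finset.sum_congr rfl
        intro v _
        have := count_zero (V := V) q {v}
        rw [Finset.card_singleton, pow_one] at this
        rw [← this, mul_comm]
      _ = _ := by simp
  by_contra hcon
  push Not at hcon
  have hall : ∀ c, 4608 * (A c).card ≤ q * (B c).card := by
    intro c
    have := hcon (B c) (A c) (hBind c) (by
      intro a ha
      simp only [A, hA₀, Finset.mem_filter, Finset.mem_univ, true_and] at ha
      exact ⟨ha.2, ha.1⟩)
    rwa [hq]
  have h1 : 4608 * ∑ c, (A c).card ≤ q * ∑ c, (B c).card := by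
    rw [Finset.mul_sum, Finset.mul_sum]
    exact Finset.sum_le_sum (fun c _ => hall c)
  have h2 : 0 < Fintype.card V * q ^ Fintype.card V :=
    Nat.mul_pos Fintype.card_pos (pow_pos (by omega) _)
  omega

/-! ### Assembling -/

lemma noC4_of {V : Type} {G : SimpleGraph V} (h : ¬ HasSubgraphCopy G (cycleGraph 4)) : NoC4 G := by
  intro a b x y hab hax hbx hay hby
  by_contra hxy
  apply h
  have h1 := hax.ne
  have h2 := hbx.ne
  have h3 := hay.ne
  have h4 := hby.ne
  refine ⟨⟨![a, x, b, y], ?_⟩, ?_⟩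
  · intro i j hij
    rw [cycleGraph_adj] at hij
    fin_cases i <;> fin_cases j <;>
      first
        | exact absurd hij (by decide)
        | simpa using hax
        | simpa using hay
        | simpa using hbx
        | simpa using hby
        | simpa using hax.symm
        | simpa using hay.symm
        | simpa using hbx.symm
        | simpa using hby.symm
  · intro i j hij
    fin_cases i <;> fin_cases j <;> simp_all

lemma hasInducedSubdivision_of_embedding {V W U : Type} {G : SimpleGraph V} {H : SimpleGraph W}
    {S : SimpleGraph U} (hS : SubdIso H S) (f : U → V) (hf : Function.Injective f)
    (hadj : ∀ u v, G.Adj (f u) (f v) ↔ S.Adj u v) : HasInducedSubdivision G H := by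
  obtain ⟨U', T, hT, ⟨φ⟩⟩ := hS
  refine ⟨U', T, hT, Set.range f, ⟨?_⟩⟩
  have e : S ≃g G.induce (Set.range f) :=
    ⟨Equiv.ofInjective f hf, by intro u v; exact hadj u v⟩
  exact e.symm.trans φ.symm

open Classical in
lemma core {V W : Type} [Fintype V] [Nonempty V] {G : SimpleGraph V} (hG : NoC4 G)
    {H : SimpleGraph W} (K : ℕ)
    (hK : ∀ (V : Type) [Fintype V] [Nonempty V] (F : SimpleGraph V),
      K * Fintype.card V ≤ e2 F Finset.univ → HasTop F H) (d : ℕ)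
    (hd : 4 ≤ d) (hdK : 2 * (1536 * K) * 2 ^ (16 * (1536 * K)) ≤ 4 * d)
    (hmin : ∀ v, d ≤ dg G Finset.univ v)
    (out : V → Finset V) (hout1 : ∀ v, (out v).card ≤ d) (hout2 : ∀ u, ∀ v ∈ out u, G.Adj u v)
    (hout3 : ∀ u v, G.Adj u v → v ∈ out u ∨ u ∈ out v) :
    ∃ (U : Type) (S : SimpleGraph U) (f : U → V), SubdIso H S ∧ Function.Injective f ∧
      ∀ u v, G.Adj (f u) (f v) ↔ S.Adj u v := by
  obtain ⟨B, A, hB, hA, hBA⟩ := sampling G hG d hd hmin out hout1 hout2 hout3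
  obtain ⟨W, hWA, hW, hWc⟩ := aks G hG (1536 * K) (4 * d) hdK A (by
    intro v hv
    have := (hA v hv).2
    rw [dg_eq_card] at this
    exact (Finset.card_le_card (Finset.filter_subset_filter _ (Finset.subset_univ _))).trans this)
  have hWB : K * B.card ≤ W.card := by
    have h1 : (4 * d * 4608) * (K * B.card) ≤ (4 * d * 4608) * W.card := by
      calc (4 * d * 4608) * (K * B.card) = 1536 * K * (12 * d * B.card) := by ring
        _ ≤ 1536 * K * (4608 * A.card) := Nat.mul_le_mul_left _ hBA.le
        _ = 4608 * (1536 * K * A.card) := by ring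
        _ ≤ 4608 * (4 * d * W.card) := Nat.mul_le_mul_left _ hWc
        _ = _ := by ring
    exact Nat.le_of_mul_le_mul_left h1 (by omega)
  have hAne : A.Nonempty := by
    rw [← Finset.card_pos]; omega
  obtain ⟨a₀, ha₀⟩ := hAne
  obtain ⟨b₀, hb₀, -⟩ := (hA a₀ ha₀).1
  have : Nonempty {b // b ∈ B} := ⟨⟨b₀, hb₀⟩⟩
  -- the auxiliary graph
  let F : SimpleGraph {b // b ∈ B} :=
    { Adj := fun x y => x ≠ y ∧ ∃ a ∈ W, G.Adj a x.1 ∧ G.Adj a y.1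
      symm := ⟨fun x y h => ⟨h.1.symm, h.2.choose, h.2.choose_spec.1, h.2.choose_spec.2.2,
        h.2.choose_spec.2.1⟩⟩
      loopless := ⟨fun x h => h.1 rfl⟩ }
  have hF : W.card ≤ e2 F Finset.univ := by
    have e1 : e2 F Finset.univ = (Finset.univ.filter
        (fun p : {b // b ∈ B} × {b // b ∈ B} => F.Adj p.1 p.2)).card := by
      rw [Finset.card_filter, Fintype.sum_prod_type]
      unfold e2 dg
      refine Finset.sum_congr rfl fun x _ => Finset.sum_congr rfl fun y _ => ?_
      congr
    rw [e1]
    have hch : ∀ a : {a // a ∈ W}, ∃ p : {b // b ∈ B} × {b // b ∈ B}, p.1 ≠ p.2 ∧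
        G.Adj a.1 p.1.1 ∧ G.Adj a.1 p.2.1 := by
      intro a
      obtain ⟨b₁, h1, b₂, h2, h3, h4, h5, -⟩ := (hA a.1 (hWA a.2)).1
      exact ⟨(⟨b₁, h1⟩, ⟨b₂, h2⟩), by simpa using h3, h4, h5⟩
    choose p hp using hch
    rw [← Finset.card_attach]
    refine Finset.card_le_card_of_injOn p ?_ ?_
    · intro a _
      simp only [Finset.coe_filter, Finset.mem_univ, true_and, Set.mem_ofPred_eq]
      exact ⟨(hp a).1, a.1, a.2, (hp a).2⟩
    · intro a _ a' _ haa
      have h1 := hp a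
      have h2 := hp a'
      rw [← haa] at h2
      apply Subtype.ext
      exact hG _ _ _ _ (fun h => h1.1 (Subtype.ext h)) h1.2.1.symm h1.2.2.symm h2.2.1.symm
        h2.2.2.symm
  obtain ⟨U, S, hS, f, hf, hfa⟩ := hK {b // b ∈ B} F (by
    rw [Fintype.card_coe]
    exact hWB.trans hF)
  have hUfin : Finite U := Finite.of_injective f hf
  have : Fintype U := Fintype.ofFinite U
  let E : Finset (Sym2 U) := Finset.univ.filter (fun e => e ∈ S.edgeSet)
  have hE : ∀ e, e ∈ E ↔ e ∈ S.edgeSet := by intro e; simp [E]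
  have hα : ∀ e : {e // e ∈ E}, ∃ a ∈ W, ∀ u, G.Adj a (f u).1 ↔ u ∈ e.1 := by
    rintro ⟨e, he⟩
    rw [hE] at he
    induction e using Sym2.ind with
    | _ x y =>
    obtain ⟨hne, a, ha, hax, hay⟩ := hfa x y he
    refine ⟨a, ha, ?_⟩
    obtain ⟨b₁, h1, b₂, h2, h3, h4, h5, h6⟩ := (hA a (hWA ha)).1
    intro u
    simp only [Sym2.mem_iff]
    constructor
    · intro hu
      have hx := h6 _ (f x).2 hax
      have hy := h6 _ (f y).2 hay
      have hu' := h6 _ (f u).2 hu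
      have hne' : (f x).1 ≠ (f y).1 := fun h => hne (Subtype.ext h)
      have hfin : (f u).1 = (f x).1 ∨ (f u).1 = (f y).1 := by
        rcases hx with hx | hx <;> rcases hy with hy | hy <;> rcases hu' with hu' | hu' <;>
          simp_all
      rcases hfin with h | h
      · exact Or.inl (hf (Subtype.ext h))
      · exact Or.inr (hf (Subtype.ext h))
    · rintro (rfl | rfl)
      · exact hax
      · exact hay
  choose α hαW hα using hα
  have hdisj : ∀ a ∈ W, a ∉ B := by
    intro a ha haB
    obtain ⟨b₁, h1, b₂, h2, h3, h4, h5, h6⟩ := (hA a (hWA ha)).1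
    exact hB a haB b₁ h1 h4
  refine ⟨U ⊕ {e // e ∈ E}, psd S E, Sum.elim (fun u => (f u).1) α,
    psd_subdIso hS E (fun e he => (hE e).1 he), ?_, ?_⟩
  · rintro (u | e) (v | e') huv
    · rw [hf (Subtype.ext huv)]
    · exact absurd (f u).2 (by
        have : (f u).1 = α e' := huv
        rw [this]; exact hdisj _ (hαW e'))
    · exact absurd (f v).2 (by
        have : α e = (f v).1 := huv
        rw [← this]; exact hdisj _ (hαW e))
    · have hEq : α e = α e' := huv
      congr 1
      apply Subtype.ext
      apply Sym2.ext
      intro u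
      rw [← hα e u, ← hα e' u, hEq]
  · rintro (u | e) (v | e')
    · simp only [Sum.elim_inl, psd, hE, mem_edgeSet]
      have := hB _ (f u).2 _ (f v).2
      tauto
    · simp only [Sum.elim_inl, Sum.elim_inr, psd]
      rw [G.adj_comm]
      exact hα e' u
    · simp only [Sum.elim_inl, Sum.elim_inr, psd]
      exact hα e v
    · simp only [Sum.elim_inr, psd]
      have := hW _ (hαW e) _ (hαW e')
      tauto

open Classical in
lemma two_mul_edges {V : Type} [Fintype V] (G : SimpleGraph V) :
    2 * G.edgeSet.ncard = e2 G Finset.univ := by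
  have h1 : ∀ v, dg G Finset.univ v = G.degree v := by
    intro v
    rw [dg_eq_card, ← card_neighborFinset_eq_degree]
    congr 1
    ext x
    simp
  unfold e2
  simp only [h1]
  rw [sum_degrees_eq_twice_card_edges, ← coe_edgeFinset, Set.ncard_coe_finset]

/-- For every graph `H` there is a constant `k` such that every
`C₄`-subgraph-free graph with no induced subdivision of `H` has average degree less
than `k`. -/
theorem stmt_14 {VH : Type} [Fintype VH] (H : SimpleGraph VH) :
    ∃ k : ℝ, ∀ (V : Type) [Fintype V], ∀ G : SimpleGraph V,
      ¬ HasSubgraphCopy G (cycleGraph 4) →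
      ¬ HasInducedSubdivision G H →
      avgDeg G < k := by

  classical
  obtain ⟨K, hK⟩ := mader H
  set D := 4 + 2 * (1536 * K) * 2 ^ (16 * (1536 * K)) with hD
  refine ⟨2 * (D : ℝ), ?_⟩
  intro V _ G hC4 hind
  have hG := noC4_of hC4
  by_contra hcon
  push Not at hcon
  have hDpos : (0 : ℝ) < D := by
    have : 0 < D := by omega
    exact_mod_cast this
  have hVne : Nonempty V := by
    by_contra hemp
    rw [not_nonempty_iff] at hemp
    have : avgDeg G = 0 := by simp [avgDeg]
    linarith
  have hcardpos : (0 : ℝ) < Fintype.card V := by exact_mod_cast Fintype.card_pos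
  let Q : ℕ → Prop := fun d => ∃ U : Finset V, U.Nonempty ∧ ∀ v ∈ U, d ≤ dg G U v
  have hex : ∃ d, ¬ Q (d + 1) := by
    refine ⟨Fintype.card V, ?_⟩
    rintro ⟨U, ⟨v, hv⟩, hU⟩
    have h1 := hU v hv
    rw [dg_eq_card] at h1
    have h2 := Finset.card_le_univ (U.filter (fun u => G.Adj v u))
    omega
  obtain ⟨d, hd, hdmin⟩ : ∃ d, ¬ Q (d + 1) ∧ Q d := by
    refine ⟨Nat.find hex, Nat.find_spec hex, ?_⟩
    rcases Nat.eq_zero_or_pos (Nat.find hex) with h0 | hpos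
    · rw [h0]
      exact ⟨Finset.univ, Finset.univ_nonempty, fun v _ => Nat.zero_le _⟩
    · have := Nat.find_min hex (m := Nat.find hex - 1) (by omega)
      rw [not_not, Nat.sub_add_cancel hpos] at this
      exact this
  have hdeg : ∀ S : Finset V, S.Nonempty → ∃ v ∈ S, dg G S v ≤ d := by
    intro S hS
    by_contra hc
    push Not at hc
    exact hd ⟨S, hS, fun v hv => hc v hv⟩
  obtain ⟨out, hout1, hout2, hout3⟩ := exists_orientation G d hdeg Finset.univ
  have hDd : D ≤ d := by
    have h1 := e2_le_of_orientation G d out hout1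
      (fun u v => hout3 u (Finset.mem_univ _) v (Finset.mem_univ _))
    rw [← two_mul_edges] at h1
    have h2 : (2 : ℝ) * G.edgeSet.ncard ≤ 2 * d * Fintype.card V := by exact_mod_cast h1
    have h3 : avgDeg G ≤ 2 * d := by
      unfold avgDeg
      rw [div_le_iff₀ hcardpos]
      exact h2
    have h4 : (D : ℝ) ≤ d := by linarith
    exact_mod_cast h4
  obtain ⟨U, ⟨u₀, hu₀⟩, hU⟩ := hdmin
  have : Nonempty {v // v ∈ U} := ⟨⟨u₀, hu₀⟩⟩
  let G' : SimpleGraph {v // v ∈ U} := G.comap Subtype.val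
  have hG' : NoC4 G' := by
    intro a b x y hab h1 h2 h3 h4
    exact Subtype.ext (hG a.1 b.1 x.1 y.1 (fun h => hab (Subtype.ext h)) h1 h2 h3 h4)
  obtain ⟨U', S, f, hS, hf, hadj⟩ := core (G := G') hG' K hK d (by omega) (by omega) (by
      intro v
      have h1 : dg G' Finset.univ v = dg G U v.1 := by
        unfold dg
        rw [← Finset.sum_coe_sort U]
        rfl
      rw [h1]
      exact hU v.1 v.2)
    (fun v => (out v.1).subtype (fun x => x ∈ U))
    (by
      intro v
      rw [Finset.card_subtype]
      exact (Finset.card_filter_le _ _).trans (hout1 v.1))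
    (by
      intro u v hv
      rw [Finset.mem_subtype] at hv
      exact hout2 u.1 v.1 hv)
    (by
      intro u v huv
      rw [Finset.mem_subtype, Finset.mem_subtype]
      exact hout3 u.1 (Finset.mem_univ _) v.1 (Finset.mem_univ _) huv)
  exact hind (hasInducedSubdivision_of_embedding hS (fun u => (f u).1)
    (fun a b hab => hf (Subtype.ext hab)) (fun u v => hadj u v))
end
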